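/- arXiv:0806.4669 — 3 statements merged into one kernel-verified Lean document; each statement's English description precedes it below -/
import Mathlib

section
/- Suppose the real numbers r_1, …, r_n are chosen so that the hyperplane arrangement H is simple. Then for 1 ≤ m ≤ n−1 the relative interior of mP_B contains no lattice points, and the relative interior of nP_B contains exactly Σ_{F ∈ M_B} #(BOX(F) ∩ ℤ^d) · R^bd_F lattice points. -/
open scoped BigOperators Pointwise
open Polynomial

noncomputable section

namespace LawrencePaper

attribute [local instance] Classical.propDecidable

/-- The real vector associated to an integer vector. -/
def toR (d : ℕ) (v : Fin d → ℤ) : Fin d → ℝ := fun j => (v j : ℝ)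

/-- The `i`-th standard basis vector of `ℝ^n`. -/
def e (n : ℕ) (i : Fin n) : Fin n → ℝ := Pi.single i 1

/-- The Lawrence polytope of the configuration `b`: the convex hull of the points
`(b i, e i)` and `(0, e i)`. -/
def lawrencePolytope (d n : ℕ) (b : Fin n → Fin d → ℤ) : Set ((Fin d → ℝ) × (Fin n → ℝ)) :=
  convexHull ℝ
    ((Set.range fun i => (toR d (b i), e n i)) ∪
      (Set.range fun i => ((0 : Fin d → ℝ), e n i)))

/-- The number of lattice points in the `m`-th dilate of `P`. -/
def latticeCount (d n : ℕ) (P : Set ((Fin d → ℝ) × (Fin n → ℝ))) (m : ℕ) : ℕ :=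
  Nat.card {z : (Fin d → ℤ) × (Fin n → ℤ) |
    (toR d z.1, fun j => (z.2 j : ℝ)) ∈ (m : ℝ) • P}

/-- `δ` is the Ehrhart δ-polynomial of the `(d+n-1)`-dimensional polytope `P ⊆ ℝ^{d+n}`:
it has degree at most `n+d-1` and satisfies
`(1-t)^{n+d} * Σ_{m ≥ 0} f_P(m) t^m = δ(t)` as formal power series. -/
def IsDeltaPoly (d n : ℕ) (P : Set ((Fin d → ℝ) × (Fin n → ℝ))) (δ : Polynomial ℤ) : Prop :=
  δ.natDegree ≤ n + d - 1 ∧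
    (1 - PowerSeries.X) ^ (n + d) *
      PowerSeries.mk (fun m => (latticeCount d n P m : ℤ)) = (δ : PowerSeries ℤ)

/-- Membership in the matroid `M_B`: the index set `F` corresponds to a linearly
independent subset of the configuration. -/
def memMatroid (d n : ℕ) (b : Fin n → Fin d → ℤ) (F : Finset (Fin n)) : Prop :=
  LinearIndependent ℝ (fun i : F => toR d (b i.1))

/-- The linear span of the vectors indexed by `F`. -/
def spanF (d n : ℕ) (b : Fin n → Fin d → ℤ) (F : Finset (Fin n)) : Submodule ℝ (Fin d → ℝ) :=
  Submodule.span ℝ ((fun i => toR d (b i)) '' F)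

/-- The dimension of an element `F` of the matroid: the dimension of its span. -/
def dimF (d n : ℕ) (b : Fin n → Fin d → ℤ) (F : Finset (Fin n)) : ℕ :=
  Module.finrank ℝ (spanF d n b F)

/-- `BOX(F) = { Σ_{i ∈ F} α_i b_i  :  0 < α_i < 1 }`; `BOX(∅) = {0}`. -/
def box (d n : ℕ) (b : Fin n → Fin d → ℤ) (F : Finset (Fin n)) : Set (Fin d → ℝ) :=
  {x | ∃ α : Fin n → ℝ, (∀ i ∈ F, 0 < α i ∧ α i < 1) ∧ x = ∑ i ∈ F, α i • toR d (b i)}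

/-- The number of lattice points in `BOX(F)`. -/
def boxCount (d n : ℕ) (b : Fin n → Fin d → ℤ) (F : Finset (Fin n)) : ℕ :=
  Nat.card {z : Fin d → ℤ | toR d z ∈ box d n b F}

/-- Membership in the restricted matroid `M_F`: the index set `G` corresponds to a linearly
independent subset of the induced configuration `B_F` in `ℝ^d / Span F`. -/
def memMatroidRes (d n : ℕ) (b : Fin n → Fin d → ℤ) (F G : Finset (Fin n)) : Prop :=
  (∀ i ∈ G, toR d (b i) ∉ spanF d n b F) ∧
    LinearIndependent ℝ (fun i : G => (spanF d n b F).mkQ (toR d (b i.1)))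

/-- The dimension of an element `G` of the restricted matroid `M_F`: the dimension of the
span of the corresponding vectors in `ℝ^d / Span F`. -/
def dimRes (d n : ℕ) (b : Fin n → Fin d → ℤ) (F G : Finset (Fin n)) : ℕ :=
  Module.finrank ℝ (Submodule.span ℝ ((fun i => (spanF d n b F).mkQ (toR d (b i))) '' G))

/-- `f_i`: the number of elements of the restricted matroid `M_F` of dimension `i`. -/
def fRes (d n : ℕ) (b : Fin n → Fin d → ℤ) (F : Finset (Fin n)) (i : ℕ) : ℕ :=
  Nat.card {G : Finset (Fin n) | memMatroidRes d n b F G ∧ dimRes d n b F G = i}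

/-- The `h`-polynomial `h_F(t) = Σ_{i=0}^{codim F} f_i t^i (1-t)^{codim F - i}` of `M_F`. -/
def hPoly (d n : ℕ) (b : Fin n → Fin d → ℤ) (F : Finset (Fin n)) : Polynomial ℤ :=
  ∑ i ∈ Finset.range (d - dimF d n b F + 1),
    C (fRes d n b F i : ℤ) * X ^ i * (1 - X) ^ (d - dimF d n b F - i)

/-- The hyperplane `H_i = {u : ⟨u, b_i⟩ = r_i}`. -/
def hyperplane (d n : ℕ) (b : Fin n → Fin d → ℤ) (r : Fin n → ℝ) (i : Fin n) :
    Set (Fin d → ℝ) :=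
  {u | ∑ j, u j * (b i j : ℝ) = r i}

/-- The arrangement `H` is simple: the intersection of any `l` of the hyperplanes is
either empty or has codimension `l`. -/
def Simple (d n : ℕ) (b : Fin n → Fin d → ℤ) (r : Fin n → ℝ) : Prop :=
  ∀ s : Finset (Fin n), (⋂ i ∈ s, hyperplane d n b r i) = ∅ ∨
    ∀ x ∈ ⋂ i ∈ s, hyperplane d n b r i,
      Module.finrank ℝ
        (Submodule.span ℝ ((fun u => u - x) '' ⋂ i ∈ s, hyperplane d n b r i)) + s.card = d

/-- The affine subspace `A_F = ⋂_{i ∈ F} H_i`. -/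
def flat (d n : ℕ) (b : Fin n → Fin d → ℤ) (r : Fin n → ℝ) (F : Finset (Fin n)) :
    Set (Fin d → ℝ) :=
  ⋂ i ∈ F, hyperplane d n b r i

/-- The cell of the restricted arrangement `H^F` containing the point `u ∈ A_F`: all points
of `A_F` satisfying the same relations `<`, `=`, `>` as `u` with respect to each hyperplane
of `H^F`. -/
def cellOf (d n : ℕ) (b : Fin n → Fin d → ℤ) (r : Fin n → ℝ) (F : Finset (Fin n))
    (u : Fin d → ℝ) : Set (Fin d → ℝ) :=
  {v ∈ flat d n b r F | ∀ i : Fin n, toR d (b i) ∉ spanF d n b F →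
    (((∑ j, v j * (b i j : ℝ)) < r i ↔ (∑ j, u j * (b i j : ℝ)) < r i) ∧
      ((∑ j, v j * (b i j : ℝ)) = r i ↔ (∑ j, u j * (b i j : ℝ)) = r i))}

/-- `f^bd_k`: the number of bounded cells of the restricted arrangement `H^F` of dimension
`k` (the dimension of a cell being the dimension of its affine span). -/
def fBd (d n : ℕ) (b : Fin n → Fin d → ℤ) (r : Fin n → ℝ) (F : Finset (Fin n)) (k : ℕ) : ℕ :=
  Nat.card {Cs : Set (Fin d → ℝ) | (∃ u ∈ flat d n b r F, Cs = cellOf d n b r F u) ∧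
    Bornology.IsBounded Cs ∧ Module.finrank ℝ (vectorSpan ℝ Cs) = k}

/-- `h^bd_F(t) = Σ_{i=0}^{codim F} f^bd_i (t-1)^i`. -/
def hBdPoly (d n : ℕ) (b : Fin n → Fin d → ℤ) (r : Fin n → ℝ) (F : Finset (Fin n)) :
    Polynomial ℤ :=
  ∑ i ∈ Finset.range (d - dimF d n b F + 1), C (fBd d n b r F i : ℤ) * (X - 1) ^ i

/-- The complement within `A_F` of the union of the hyperplanes of `H^F`. -/
def arrComplement (d n : ℕ) (b : Fin n → Fin d → ℤ) (r : Fin n → ℝ) (F : Finset (Fin n)) :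
    Set (Fin d → ℝ) :=
  flat d n b r F \ ⋃ i ∈ {i : Fin n | toR d (b i) ∉ spanF d n b F}, hyperplane d n b r i

/-- `R^bd_F`: the number of bounded regions (connected components of the complement within
`A_F` of the union of the hyperplanes) of the restricted arrangement `H^F`. -/
def boundedRegionCount (d n : ℕ) (b : Fin n → Fin d → ℤ) (r : Fin n → ℝ)
    (F : Finset (Fin n)) : ℕ :=
  Nat.card {R : Set (Fin d → ℝ) | (∃ x ∈ arrComplement d n b r F,
    R = connectedComponentIn (arrComplement d n b r F) x) ∧ Bornology.IsBounded R}

/-- `F` is a maximal linearly independent subset of the configuration. -/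
def IsMaximalIndep (d n : ℕ) (b : Fin n → Fin d → ℤ) (F : Finset (Fin n)) : Prop :=
  memMatroid d n b F ∧ ∀ G : Finset (Fin n), memMatroid d n b G → F ⊆ G → F = G

/-- The matroid `M_B` is coloop free: no element of the configuration lies in every
maximal linearly independent subset. -/
def ColoopFree (d n : ℕ) (b : Fin n → Fin d → ℤ) : Prop :=
  ∀ i : Fin n, ∃ F : Finset (Fin n), IsMaximalIndep d n b F ∧ i ∉ F

/-- `f_i`: the number of elements of the matroid `M_B` of dimension `i`. -/
def fMat (d n : ℕ) (b : Fin n → Fin d → ℤ) (i : ℕ) : ℕ :=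
  Nat.card {F : Finset (Fin n) | memMatroid d n b F ∧ dimF d n b F = i}


section Tiling

variable {ι κ : Type*} [Fintype ι] [Fintype κ]

/-- The coefficients `c` parametrise a point of the relatively open zonotopal tile dual to the
cell of the arrangement `⟨·, a i⟩ = r i` that contains `u`. -/
def TileCoeff (a : ι → κ → ℝ) (r : ι → ℝ) (u : κ → ℝ) (c : ι → ℝ) : Prop :=
  ∀ i, (r i < u ⬝ᵥ a i ∧ c i = 1) ∨ (u ⬝ᵥ a i < r i ∧ c i = 0) ∨
    (u ⬝ᵥ a i = r i ∧ 0 < c i ∧ c i < 1)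

/-- Tiles dual to different cells are disjoint. -/
theorem TileCoeff.sign_eq {a : ι → κ → ℝ} {r : ι → ℝ} {u u' : κ → ℝ} {c c' : ι → ℝ}
    (h : TileCoeff a r u c) (h' : TileCoeff a r u' c')
    (hx : ∑ i, c i • a i = ∑ i, c' i • a i) (i : ι) :
    (r i < u ⬝ᵥ a i ↔ r i < u' ⬝ᵥ a i) ∧ (u ⬝ᵥ a i = r i ↔ u' ⬝ᵥ a i = r i) := by
  have key : ∑ i, (c i - c' i) * (u ⬝ᵥ a i - u' ⬝ᵥ a i) = 0 := by
    have : (u - u') ⬝ᵥ (∑ i, c i • a i - ∑ i, c' i • a i) = 0 := by rw [hx]; simp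
    rw [← Finset.sum_sub_distrib, dotProduct_sum] at this
    rw [← this]
    refine Finset.sum_congr rfl fun i _ => ?_
    rw [← sub_smul, dotProduct_smul, sub_dotProduct, smul_eq_mul]
  have hnn : ∀ i ∈ Finset.univ, 0 ≤ (c i - c' i) * (u ⬝ᵥ a i - u' ⬝ᵥ a i) := by
    intro i _
    rcases h i with ⟨h1, h2⟩ | ⟨h1, h2⟩ | ⟨h1, h2, h3⟩ <;>
    rcases h' i with ⟨k1, k2⟩ | ⟨k1, k2⟩ | ⟨k1, k2, k3⟩ <;>
    first
    | exact mul_nonneg (by linarith) (by linarith)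
    | exact mul_nonneg_of_nonpos_of_nonpos (by linarith) (by linarith)
    | simp [h2, k2]
    | simp [h1, k1]
  have hz := (Finset.sum_eq_zero_iff_of_nonneg hnn).1 key i (Finset.mem_univ i)
  rcases mul_eq_zero.1 hz with hz | hz
  · rcases h i with ⟨h1, h2⟩ | ⟨h1, h2⟩ | ⟨h1, h2, h3⟩ <;>
    rcases h' i with ⟨k1, k2⟩ | ⟨k1, k2⟩ | ⟨k1, k2, k3⟩ <;>
    first
    | (exfalso; linarith)
    | (constructor <;> constructor <;> intro _ <;> linarith)
  · rw [sub_eq_zero.1 hz]; simp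

/-- A tile dual to a cell without nonzero recession directions lies in the open zonotope. -/
theorem TileCoeff.exists_open_coeff {a : ι → κ → ℝ} {r : ι → ℝ} {u : κ → ℝ} {c : ι → ℝ}
    (ha : Submodule.span ℝ (Set.range a) = ⊤) (h : TileCoeff a r u c)
    (hrec : ∀ v : κ → ℝ, (∀ i, (u ⬝ᵥ a i = r i → v ⬝ᵥ a i = 0) ∧
      (r i < u ⬝ᵥ a i → 0 ≤ v ⬝ᵥ a i) ∧ (u ⬝ᵥ a i < r i → v ⬝ᵥ a i ≤ 0)) → v = 0) :
    ∃ l : ι → ℝ, (∀ i, 0 < l i ∧ l i < 1) ∧ ∑ i, l i • a i = ∑ i, c i • a i := by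
  set T : (ι → ℝ) →ₗ[ℝ] (κ → ℝ) := Fintype.linearCombination ℝ a with hT
  have hTa : ∀ l, T l = ∑ i, l i • a i := fun l => Fintype.linearCombination_apply ℝ a l
  have hsurj : Function.Surjective T := by
    rw [← LinearMap.range_eq_top, Fintype.range_linearCombination, ha]
  have hc : ∀ i, 0 ≤ c i ∧ c i ≤ 1 := by
    intro i
    rcases h i with ⟨h1, h2⟩ | ⟨h1, h2⟩ | ⟨h1, h2, h3⟩ <;> constructor <;> linarith
  set Q : Set (ι → ℝ) := Set.univ.pi fun _ => Set.Ioo (0 : ℝ) 1 with hQ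
  have hQo : IsOpen (T '' Q) :=
    T.isOpenMap_of_finiteDimensional hsurj _
      (isOpen_set_pi Set.finite_univ fun _ _ => isOpen_Ioo)
  have hQc : Convex ℝ (T '' Q) :=
    (convex_pi fun _ _ => convex_Ioo (0 : ℝ) 1).linear_image T
  by_contra hcon
  have hx : T c ∉ T '' Q := by
    rintro ⟨l, hl, hlx⟩
    refine hcon ⟨l, fun i => ?_, by rw [← hTa, ← hTa, hlx]⟩
    exact hl i (Set.mem_univ i)
  obtain ⟨f, hf⟩ := geometric_hahn_banach_open_point hQc hQo hx
  set v : κ → ℝ := fun j => f (Pi.single j 1) with hv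
  have hfv : ∀ y, f y = v ⬝ᵥ y := by
    intro y
    have := LinearMap.pi_apply_eq_sum_univ (f : (κ → ℝ) →ₗ[ℝ] ℝ) y
    simp only [ContinuousLinearMap.coe_coe, smul_eq_mul] at this
    rw [this, dotProduct]
    refine Finset.sum_congr rfl fun j _ => ?_
    rw [mul_comm]
    congr 2
    ext k
    simp [Pi.single_apply, eq_comm]
  have hfle : ∀ l : ι → ℝ, (∀ i, 0 ≤ l i ∧ l i ≤ 1) → f (T l) ≤ f (T c) := by
    intro l hl
    have hcl : l ∈ closure Q := by
      rw [hQ, closure_pi_set]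
      intro i _
      rw [closure_Ioo (by norm_num)]
      exact hl i
    have hcont : Continuous fun l => f (T l) :=
      f.continuous.comp T.continuous_of_finiteDimensional
    have hsub : closure Q ⊆ {l | f (T l) ≤ f (T c)} :=
      closure_minimal (fun l hl => (hf _ ⟨l, hl, rfl⟩).le)
        (isClosed_le hcont continuous_const)
    exact hsub hcl
  have hmove : ∀ i (t : ℝ), 0 ≤ t → t ≤ 1 → (t - c i) * (v ⬝ᵥ a i) ≤ 0 := by
    intro i t h0 h1
    have hle := hfle (c + Pi.single i (t - c i)) (by
      intro j
      by_cases hj : j = i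
      · subst hj; simp [h0, h1]
      · simp [hj, hc j])
    have : T (Pi.single i (t - c i)) = (t - c i) • a i := by
      rw [hTa, Finset.sum_eq_single i]
      · simp
      · intro j _ hj; simp [hj]
      · simp
    rw [map_add, map_add, this, map_smul, hfv (a i), smul_eq_mul] at hle
    linarith
  have hv0 : v = 0 := by
    refine hrec v fun i => ⟨fun hi => ?_, fun hi => ?_, fun hi => ?_⟩
    · have m0 := hmove i 0 le_rfl zero_le_one
      have m1 := hmove i 1 zero_le_one le_rfl
      rcases h i with ⟨h1, h2⟩ | ⟨h1, h2⟩ | ⟨h1, h2, h3⟩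
      · linarith
      · linarith
      · apply le_antisymm
        · by_contra! hp; nlinarith
        · by_contra! hp; nlinarith
    · have m0 := hmove i 0 le_rfl zero_le_one
      rcases h i with ⟨h1, h2⟩ | ⟨h1, h2⟩ | ⟨h1, h2, h3⟩
      · rw [h2] at m0; linarith
      · linarith
      · linarith
    · have m0 := hmove i 1 zero_le_one le_rfl
      rcases h i with ⟨h1, h2⟩ | ⟨h1, h2⟩ | ⟨h1, h2, h3⟩
      · linarith
      · rw [h2] at m0; linarith
      · linarith
  have hmid : T (fun _ => 1 / 2) ∈ T '' Q :=
    ⟨_, fun i _ => by constructor <;> norm_num, rfl⟩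
  have := hf _ hmid
  rw [hfv, hfv, hv0] at this
  simp at this

/-- The convex piecewise linear function whose linearity domains are the cells of the
arrangement, tilted by the point of the zonotope with coefficients `l`. -/
def tilted (a : ι → κ → ℝ) (r l : ι → ℝ) (u : κ → ℝ) : ℝ :=
  ∑ i, (max 0 (u ⬝ᵥ a i - r i) - l i * (u ⬝ᵥ a i - r i))

theorem continuous_tilted (a : ι → κ → ℝ) (r l : ι → ℝ) : Continuous (tilted a r l) := by
  unfold tilted dotProduct
  fun_prop

theorem isBounded_tilted_le {a : ι → κ → ℝ} (r : ι → ℝ) {l : ι → ℝ}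
    (hinj : ∀ v : κ → ℝ, (∀ i, v ⬝ᵥ a i = 0) → v = 0)
    (hl : ∀ i, 0 < l i ∧ l i < 1) (C : ℝ) : Bornology.IsBounded {u | tilted a r l u ≤ C} := by
  set T : (κ → ℝ) →ₗ[ℝ] (ι → ℝ) := (Matrix.mulVecLin (Matrix.of a)) with hT
  have hTa : ∀ u i, T u i = u ⬝ᵥ a i := fun u i => by
    rw [dotProduct_comm]; rfl
  have hker : LinearMap.ker T = ⊥ := by
    rw [LinearMap.ker_eq_bot']
    intro v hv
    exact hinj v fun i => by rw [← hTa, hv]; rfl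
  obtain ⟨K, -, hK⟩ := T.exists_antilipschitzWith hker
  have hbox : Bornology.IsBounded (Set.univ.pi fun i =>
      Set.Icc (r i - C / l i - C / (1 - l i)) (r i + C / l i + C / (1 - l i))) :=
    Bornology.IsBounded.pi fun i => Metric.isBounded_Icc _ _
  refine (hK.isBounded_preimage hbox).subset ?_
  intro u hu i _
  have hnn : ∀ i ∈ Finset.univ, 0 ≤ max 0 (u ⬝ᵥ a i - r i) - l i * (u ⬝ᵥ a i - r i) := by
    intro i _
    have := hl i
    rcases le_total 0 (u ⬝ᵥ a i - r i) with h | h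
    · rw [max_eq_right h]; nlinarith
    · rw [max_eq_left h]; nlinarith
  have hi := (Finset.single_le_sum hnn (Finset.mem_univ i)).trans hu
  have h0 := (hnn i (Finset.mem_univ i)).trans hi
  obtain ⟨l0, l1⟩ := hl i
  have l1' : 0 < 1 - l i := by linarith
  have e1 : 0 ≤ C / l i := by positivity
  have e2 : 0 ≤ C / (1 - l i) := by positivity
  rw [hTa]
  rcases le_total 0 (u ⬝ᵥ a i - r i) with h | h
  · rw [max_eq_right h] at hi
    have : u ⬝ᵥ a i - r i ≤ C / (1 - l i) := by rw [le_div_iff₀ l1']; linarith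
    constructor <;> linarith
  · rw [max_eq_left h] at hi
    have : -(u ⬝ᵥ a i - r i) ≤ C / l i := by rw [le_div_iff₀ l0]; linarith
    constructor <;> linarith

/-- `tilted` is affine near `u` along every ray starting at `u`. -/
theorem exists_tilted_add_smul (a : ι → κ → ℝ) (r l : ι → ℝ) (u v : κ → ℝ) :
    ∃ t : ℝ, 0 < t ∧ (∀ i, u ⬝ᵥ a i ≠ r i → (u + t • v) ⬝ᵥ a i ≠ r i) ∧
      tilted a r l (u + t • v) = tilted a r l u + t *
        (v ⬝ᵥ ∑ i with r i < u ⬝ᵥ a i, a i + ∑ i with u ⬝ᵥ a i = r i, max 0 (v ⬝ᵥ a i) -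
          v ⬝ᵥ ∑ i, l i • a i) := by
  have hev : ∀ i, ∀ᶠ t : ℝ in nhdsWithin 0 (Set.Ioi 0),
      (r i < u ⬝ᵥ a i → r i < (u + t • v) ⬝ᵥ a i) ∧
      (u ⬝ᵥ a i < r i → (u + t • v) ⬝ᵥ a i < r i) := by
    intro i
    have hc : Continuous fun t : ℝ => (u + t • v) ⬝ᵥ a i := by
      unfold dotProduct; fun_prop
    have ht : Filter.Tendsto (fun t : ℝ => (u + t • v) ⬝ᵥ a i) (nhds 0) (nhds (u ⬝ᵥ a i)) := by
      simpa using hc.tendsto 0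
    refine Filter.Eventually.filter_mono nhdsWithin_le_nhds (Filter.Eventually.and ?_ ?_)
    · by_cases h : r i < u ⬝ᵥ a i
      · filter_upwards [ht.eventually_const_lt h] with t ht _ using ht
      · exact Filter.Eventually.of_forall fun t h' => absurd h' h
    · by_cases h : u ⬝ᵥ a i < r i
      · filter_upwards [ht.eventually_lt_const h] with t ht _ using ht
      · exact Filter.Eventually.of_forall fun t h' => absurd h' h
  obtain ⟨t, ht, ht0⟩ := ((Filter.eventually_all.2 hev).and self_mem_nhdsWithin).exists
  have ht0 : 0 < t := ht0
  refine ⟨t, ht0, fun i hi => ?_, ?_⟩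
  · rcases lt_or_gt_of_ne hi with h | h
    · exact ((ht i).2 h).ne
    · exact ((ht i).1 h).ne'
  · rw [dotProduct_sum, dotProduct_sum, Finset.sum_filter, Finset.sum_filter, tilted, tilted,
      ← Finset.sum_add_distrib, ← Finset.sum_sub_distrib, Finset.mul_sum,
      ← Finset.sum_add_distrib]
    refine Finset.sum_congr rfl fun i _ => ?_
    have hexp : (u + t • v) ⬝ᵥ a i = u ⬝ᵥ a i + t * (v ⬝ᵥ a i) := by
      rw [add_dotProduct, smul_dotProduct, smul_eq_mul]
    obtain ⟨h1, h2⟩ := ht i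
    rw [hexp] at h1 h2 ⊢
    rw [dotProduct_smul, smul_eq_mul]
    rcases lt_trichotomy (u ⬝ᵥ a i) (r i) with h | h | h
    · have h' := h2 h
      rw [max_eq_left (by linarith), max_eq_left (by linarith), if_neg (by linarith),
        if_neg h.ne]
      ring
    · rw [if_neg (by linarith), if_pos h, h, sub_self, max_self, add_sub_cancel_left]
      have : max 0 (t * (v ⬝ᵥ a i)) = t * max 0 (v ⬝ᵥ a i) := by
        rw [mul_max_of_nonneg _ _ ht0.le, mul_zero]
      rw [this]; ring
    · have h' := h1 h
      rw [max_eq_right (by linarith), max_eq_right (by linarith), if_pos h, if_neg h.ne']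
      ring

/-- Every point of the open zonotope lies in a tile dual to a bounded cell. -/
theorem exists_tileCoeff {a : ι → κ → ℝ} {r l : ι → ℝ}
    (hinj : ∀ v : κ → ℝ, (∀ i, v ⬝ᵥ a i = 0) → v = 0)
    (hdual : ∀ (u : κ → ℝ) i, u ⬝ᵥ a i = r i →
      ∃ v : κ → ℝ, v ⬝ᵥ a i = 1 ∧ ∀ j, j ≠ i → u ⬝ᵥ a j = r j → v ⬝ᵥ a j = 0)
    (hl : ∀ i, 0 < l i ∧ l i < 1) :
    ∃ u c, TileCoeff a r u c ∧ ∑ i, c i • a i = ∑ i, l i • a i ∧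
      Bornology.IsBounded {w | TileCoeff a r w c} := by
  have hmin : ∃ u, ∀ w, tilted a r l u ≤ tilted a r l w := by
    have hcpt : IsCompact {u | tilted a r l u ≤ tilted a r l 0} :=
      Metric.isCompact_of_isClosed_isBounded
        (isClosed_le (continuous_tilted a r l) continuous_const)
        (isBounded_tilted_le r hinj hl _)
    obtain ⟨u, hu, hmin⟩ := hcpt.exists_isMinOn ⟨0, le_refl (tilted a r l 0)⟩ (continuous_tilted a r l).continuousOn
    refine ⟨u, fun w => ?_⟩
    rcases le_total (tilted a r l w) (tilted a r l 0) with h | h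
    · exact hmin h
    · exact le_trans hu h
  set Z : (κ → ℝ) → Finset ι := fun u => {i | u ⬝ᵥ a i = r i} with hZ
  obtain ⟨u, hu, hcard⟩ : ∃ u, (∀ w, tilted a r l u ≤ tilted a r l w) ∧
      ∀ u', (∀ w, tilted a r l u' ≤ tilted a r l w) → (Z u).card ≤ (Z u').card := by
    obtain ⟨u, hu, h⟩ := WellFounded.has_min (measure fun u => (Z u).card).wf
      {u | ∀ w, tilted a r l u ≤ tilted a r l w} hmin
    exact ⟨u, hu, fun u' hu' => not_lt.1 (h u' hu')⟩
  set x := ∑ i, l i • a i with hx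
  set p := ∑ i with r i < u ⬝ᵥ a i, a i with hp
  set D : (κ → ℝ) → ℝ := fun v => v ⬝ᵥ p + ∑ i ∈ Z u, max 0 (v ⬝ᵥ a i) - v ⬝ᵥ x with hD
  have hDnn : ∀ v, 0 ≤ D v := by
    intro v
    obtain ⟨t, ht, -, heq⟩ := exists_tilted_add_smul a r l u v
    have := hu (u + t • v)
    rw [heq] at this
    exact nonneg_of_mul_nonneg_right (by linarith : 0 ≤ t * D v) ht
  have hDpos : ∀ v, ∀ i ∈ Z u, v ⬝ᵥ a i ≠ 0 → D v ≠ 0 := by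
    intro v i hi hvi hDv
    obtain ⟨t, ht, hne, heq⟩ := exists_tilted_add_smul a r l u v
    have heq' : tilted a r l (u + t • v) = tilted a r l u := by
      rw [heq]
      change _ + t * D v = _
      rw [hDv]; ring
    have hle := hcard (u + t • v) fun w => by rw [heq']; exact hu w
    have hlt : (Z (u + t • v)).card < (Z u).card := by
      apply Finset.card_lt_card
      rw [Finset.ssubset_iff_of_subset]
      · refine ⟨i, hi, ?_⟩
        simp only [hZ, Finset.mem_filter, Finset.mem_univ, true_and] at hi ⊢
        rw [add_dotProduct, smul_dotProduct, smul_eq_mul, hi]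
        intro h
        exact mul_ne_zero ht.ne' hvi (by linarith)
      · intro j hj
        simp only [hZ, Finset.mem_filter, Finset.mem_univ, true_and] at hj ⊢
        by_contra h
        exact hne j h hj
    omega
  have hdual' : ∀ i, ∃ v : κ → ℝ, i ∈ Z u →
      v ⬝ᵥ a i = 1 ∧ ∀ j ∈ Z u, j ≠ i → v ⬝ᵥ a j = 0 := by
    intro i
    by_cases hi : u ⬝ᵥ a i = r i
    · obtain ⟨v, hv, hv'⟩ := hdual u i hi
      exact ⟨v, fun _ => ⟨hv, fun j hj hji => hv' j hji (by simpa [hZ] using hj)⟩⟩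
    · exact ⟨0, fun h => absurd (by simpa [hZ] using h) hi⟩
  choose w hw using hdual'
  have hsum : ∀ (s : ι → ℝ) (i), i ∈ Z u →
      (∑ k ∈ Z u, s k • w k) ⬝ᵥ a i = s i := by
    intro s i hi
    rw [sum_dotProduct, Finset.sum_eq_single i]
    · rw [smul_dotProduct, (hw i hi).1]; simp
    · intro k hk hki
      rw [smul_dotProduct, (hw k hk).2 i hi (Ne.symm hki)]; simp
    · exact fun h => absurd hi h
  have hort : ∀ v : κ → ℝ, (∀ i ∈ Z u, v ⬝ᵥ a i = 0) → v ⬝ᵥ (x - p) = 0 := by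
    intro v hv
    have h1 := hDnn v
    have h2 := hDnn (-v)
    have e1 : ∑ i ∈ Z u, max 0 (v ⬝ᵥ a i) = 0 :=
      Finset.sum_eq_zero fun i hi => by rw [hv i hi]; simp
    have e2 : ∑ i ∈ Z u, max 0 ((-v) ⬝ᵥ a i) = 0 :=
      Finset.sum_eq_zero fun i hi => by rw [neg_dotProduct, hv i hi]; simp
    simp only [hD, e1, e2] at h1 h2
    rw [neg_dotProduct, neg_dotProduct] at h2
    rw [dotProduct_sub]
    linarith
  set α : ι → ℝ := fun i => w i ⬝ᵥ (x - p) with hα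
  have hxp : x - p = ∑ i ∈ Z u, α i • a i := by
    refine sub_eq_zero.1 (dotProduct_eq_zero _ fun v => ?_)
    have h0 := hort (v - ∑ k ∈ Z u, (v ⬝ᵥ a k) • w k) fun i hi => by
      rw [sub_dotProduct, hsum _ i hi, sub_self]
    rw [sub_dotProduct, sum_dotProduct] at h0
    rw [dotProduct_comm, dotProduct_sub, dotProduct_sum, ← h0]
    congr 1
    refine Finset.sum_congr rfl fun i _ => ?_
    rw [dotProduct_smul, smul_dotProduct, smul_eq_mul, smul_eq_mul, mul_comm]
  have hDw : ∀ i ∈ Z u, D (w i) = 1 - α i := by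
    intro i hi
    have : ∑ k ∈ Z u, max 0 (w i ⬝ᵥ a k) = 1 := by
      rw [Finset.sum_eq_single i]
      · rw [(hw i hi).1]; norm_num
      · intro k hk hki
        rw [(hw i hi).2 k hk hki]; simp
      · exact fun h => absurd hi h
    simp only [hD, hα, this, dotProduct_sub]
    ring
  have hDw' : ∀ i ∈ Z u, D (-w i) = α i := by
    intro i hi
    have : ∑ k ∈ Z u, max 0 ((-w i) ⬝ᵥ a k) = 0 := by
      refine Finset.sum_eq_zero fun k hk => ?_
      rw [neg_dotProduct]
      by_cases hki : k = i
      · rw [hki, (hw i hi).1]; norm_num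
      · rw [(hw i hi).2 k hk hki]; simp
    simp only [hD, hα, this]
    rw [neg_dotProduct, neg_dotProduct, dotProduct_sub]
    ring
  have hα01 : ∀ i ∈ Z u, 0 < α i ∧ α i < 1 := by
    intro i hi
    have p1 := lt_of_le_of_ne (hDnn (w i))
      (hDpos (w i) i hi (by rw [(hw i hi).1]; norm_num)).symm
    have p2 := lt_of_le_of_ne (hDnn (-w i))
      (hDpos (-w i) i hi (by rw [neg_dotProduct, (hw i hi).1]; norm_num)).symm
    rw [hDw i hi] at p1
    rw [hDw' i hi] at p2
    constructor <;> linarith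
  set c : ι → ℝ := fun i => if r i < u ⬝ᵥ a i then 1 else if u ⬝ᵥ a i = r i then α i else 0
    with hc
  have hcx : ∑ i, c i • a i = x := by
    have : x = p + ∑ i ∈ Z u, α i • a i := by rw [← hxp]; abel
    rw [this, hp, hZ, Finset.sum_filter, Finset.sum_filter, ← Finset.sum_add_distrib]
    refine Finset.sum_congr rfl fun i _ => ?_
    rcases lt_trichotomy (u ⬝ᵥ a i) (r i) with h | h | h
    · simp [hc, not_lt.2 h.le, h.ne]
    · simp [hc, h]
    · simp [hc, h, h.ne']
  refine ⟨u, c, fun i => ?_, hcx, ?_⟩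
  · rcases lt_trichotomy (u ⬝ᵥ a i) (r i) with h | h | h
    · exact Or.inr (Or.inl ⟨h, by simp [hc, not_lt.2 h.le, h.ne]⟩)
    · refine Or.inr (Or.inr ⟨h, ?_⟩)
      have : c i = α i := by simp [hc, h]
      rw [this]
      exact hα01 i (by simp [hZ, h])
    · exact Or.inl ⟨h, by simp [hc, h]⟩
  · refine (isBounded_tilted_le r hinj hl (∑ i, (l i - c i) * r i)).subset ?_
    intro y hy
    refine Eq.le (b := ∑ i, (l i - c i) * r i) ?_
    have hdot : ∑ i, (c i - l i) * (y ⬝ᵥ a i) = 0 := by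
      have : y ⬝ᵥ (∑ i, c i • a i - ∑ i, l i • a i) = 0 := by rw [hcx]; simp [hx]
      rw [← this, ← Finset.sum_sub_distrib, dotProduct_sum]
      refine Finset.sum_congr rfl fun i _ => ?_
      rw [← sub_smul, dotProduct_smul, smul_eq_mul]
    have hadd : ∑ i, (l i - c i) * r i =
        ∑ i, (l i - c i) * r i + ∑ i, (c i - l i) * (y ⬝ᵥ a i) := by rw [hdot, add_zero]
    rw [tilted, hadd, ← Finset.sum_add_distrib]
    refine Finset.sum_congr rfl fun i _ => ?_
    rcases hy i with ⟨h1, h2⟩ | ⟨h1, h2⟩ | ⟨h1, h2, h3⟩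
    · rw [max_eq_right (by linarith), h2]; ring
    · rw [max_eq_left (by linarith), h2]; ring
    · rw [h1]; simp; ring

end Tiling

section Arrangement

variable {d n : ℕ} {b : Fin n → Fin d → ℤ} {r : Fin n → ℝ}

theorem mem_flat {F : Finset (Fin n)} {u : Fin d → ℝ} :
    u ∈ flat d n b r F ↔ ∀ i ∈ F, u ⬝ᵥ toR d (b i) = r i := by
  simp only [flat, Set.mem_iInter]
  rfl

theorem mem_arrComplement {F : Finset (Fin n)} {u : Fin d → ℝ} :
    u ∈ arrComplement d n b r F ↔ (∀ i ∈ F, u ⬝ᵥ toR d (b i) = r i) ∧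
      ∀ i, toR d (b i) ∉ spanF d n b F → u ⬝ᵥ toR d (b i) ≠ r i := by
  rw [arrComplement, Set.mem_sdiff, mem_flat]
  simp only [Set.mem_iUnion, not_exists]
  rfl

theorem mem_cellOf {F : Finset (Fin n)} {u v : Fin d → ℝ} :
    v ∈ cellOf d n b r F u ↔ (∀ i ∈ F, v ⬝ᵥ toR d (b i) = r i) ∧
      ∀ i, toR d (b i) ∉ spanF d n b F →
        ((v ⬝ᵥ toR d (b i) < r i ↔ u ⬝ᵥ toR d (b i) < r i) ∧
          (v ⬝ᵥ toR d (b i) = r i ↔ u ⬝ᵥ toR d (b i) = r i)) := by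
  rw [← mem_flat]
  rfl

theorem toR_mem_spanF {F : Finset (Fin n)} {i : Fin n} (hi : i ∈ F) :
    toR d (b i) ∈ spanF d n b F :=
  Submodule.subset_span ⟨i, hi, rfl⟩

theorem dotProduct_eq_zero_of_mem_spanF {F : Finset (Fin n)} {v y : Fin d → ℝ}
    (hv : ∀ i ∈ F, v ⬝ᵥ toR d (b i) = 0) (hy : y ∈ spanF d n b F) : v ⬝ᵥ y = 0 := by
  induction hy using Submodule.span_induction with
  | mem x hx => obtain ⟨i, hi, rfl⟩ := hx; exact hv i hi
  | zero => simp
  | add x y _ _ hx hy => rw [dotProduct_add, hx, hy, add_zero]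
  | smul c x _ hx => rw [dotProduct_smul, hx, smul_zero]

/-- Points of one cell of `H^F` have the same position with respect to every hyperplane of the
whole arrangement. -/
theorem sign_eq_of_mem_cellOf {F : Finset (Fin n)} {u v : Fin d → ℝ}
    (hu : ∀ i ∈ F, u ⬝ᵥ toR d (b i) = r i) (hv : v ∈ cellOf d n b r F u) (i : Fin n) :
    (v ⬝ᵥ toR d (b i) < r i ↔ u ⬝ᵥ toR d (b i) < r i) ∧
      (v ⬝ᵥ toR d (b i) = r i ↔ u ⬝ᵥ toR d (b i) = r i) := by
  rw [mem_cellOf] at hv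
  by_cases hi : toR d (b i) ∈ spanF d n b F
  · have h := dotProduct_eq_zero_of_mem_spanF (v := v - u)
      (fun j hj => by rw [sub_dotProduct, hv.1 j hj, hu j hj, sub_self]) hi
    rw [sub_dotProduct, sub_eq_zero] at h
    rw [h]
    exact ⟨Iff.rfl, Iff.rfl⟩
  · exact hv.2 i hi

/-- In a simple arrangement the normals of the hyperplanes through a point have a dual
system. -/
theorem Simple.exists_dual (hr : Simple d n b r) (u : Fin d → ℝ) (s : Fin n → ℝ) :
    ∃ v : Fin d → ℝ, ∀ i, u ⬝ᵥ toR d (b i) = r i → v ⬝ᵥ toR d (b i) = s i := by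
  set Z : Finset (Fin n) := {i | u ⬝ᵥ toR d (b i) = r i} with hZ
  have huZ : u ∈ ⋂ i ∈ Z, hyperplane d n b r i :=
    mem_flat.2 fun i hi => by simpa [hZ] using hi
  set T : (Fin d → ℝ) →ₗ[ℝ] (Z → ℝ) :=
    Matrix.mulVecLin (Matrix.of fun i : Z => toR d (b i)) with hT
  have hTa : ∀ v i, T v i = v ⬝ᵥ toR d (b i) := fun v i => by
    rw [dotProduct_comm]; rfl
  have himage : (fun w => w - u) '' (⋂ i ∈ Z, hyperplane d n b r i) =
      (LinearMap.ker T : Set (Fin d → ℝ)) := by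
    have hu := mem_flat.1 huZ
    ext w
    constructor
    · rintro ⟨y, hy, rfl⟩
      have hy := mem_flat.1 hy
      rw [SetLike.mem_coe, LinearMap.mem_ker]
      ext i
      rw [hTa, sub_dotProduct, hy i i.2, hu i i.2, sub_self]
      rfl
    · intro hw
      rw [SetLike.mem_coe, LinearMap.mem_ker] at hw
      refine ⟨u + w, mem_flat.2 fun i hi => ?_, by simp⟩
      rw [add_dotProduct, hu i hi, ← hTa w ⟨i, hi⟩, hw]
      simp
  have hfin : Module.finrank ℝ (LinearMap.ker T) + Z.card = d := by
    rcases hr Z with h | h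
    · rw [h] at huZ; exact absurd huZ (Set.notMem_empty _)
    · have := h u huZ
      rwa [himage, Submodule.span_eq] at this
  have hrange : LinearMap.range T = ⊤ := by
    apply Submodule.eq_top_of_finrank_eq
    have := T.finrank_range_add_finrank_ker
    rw [Module.finrank_fin_fun] at this
    rw [Module.finrank_fintype_fun_eq_card, Fintype.card_coe]
    omega
  obtain ⟨v, hv⟩ := LinearMap.range_eq_top.1 hrange fun i => s i
  exact ⟨v, fun i hi => by rw [← hTa v ⟨i, by simpa [hZ] using hi⟩, hv]⟩

theorem Simple.memMatroid_of_mem_flat (hr : Simple d n b r) {F : Finset (Fin n)} {u : Fin d → ℝ}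
    (hu : ∀ i ∈ F, u ⬝ᵥ toR d (b i) = r i) : memMatroid d n b F := by
  rw [memMatroid, Fintype.linearIndependent_iff]
  intro g hg i
  obtain ⟨v, hv⟩ := hr.exists_dual u (Pi.single i.1 1)
  have h : v ⬝ᵥ ∑ j : F, g j • toR d (b j) = 0 := by rw [hg, dotProduct_zero]
  rw [dotProduct_sum, Finset.sum_eq_single i] at h
  · rw [dotProduct_smul, hv _ (hu i i.2)] at h
    simpa using h
  · intro j _ hj
    have hj' : (j : Fin n) ≠ i := fun h => hj (Subtype.ext h)
    rw [dotProduct_smul, hv _ (hu j j.2)]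
    simp [hj']
  · simp

theorem Simple.mem_iff_of_mem_arrComplement (hr : Simple d n b r) {F : Finset (Fin n)}
    {u : Fin d → ℝ} (hu : u ∈ arrComplement d n b r F) (i : Fin n) :
    i ∈ F ↔ u ⬝ᵥ toR d (b i) = r i := by
  rw [mem_arrComplement] at hu
  refine ⟨hu.1 i, fun hi => ?_⟩
  by_contra hiF
  have hspan : toR d (b i) ∈ spanF d n b F := by
    by_contra h
    exact hu.2 i h hi
  obtain ⟨v, hv⟩ := hr.exists_dual u (Pi.single i 1)
  have h := dotProduct_eq_zero_of_mem_spanF (v := v) (fun j hj => by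
    have hji : j ≠ i := fun h => hiF (h ▸ hj)
    rw [hv j (hu.1 j hj)]; simp [hji]) hspan
  rw [hv i hi] at h
  simp at h

theorem convex_cellOf (F : Finset (Fin n)) (u : Fin d → ℝ)
    (hu : u ∈ arrComplement d n b r F) : Convex ℝ (cellOf d n b r F u) := by
  intro x hx y hy s t hs ht hst
  rw [mem_cellOf] at hx hy ⊢
  rw [mem_arrComplement] at hu
  have hr : ∀ i, r i = s * r i + t * r i := fun i => by rw [← add_mul, hst, one_mul]
  refine ⟨fun i hi => ?_, fun i hi => ?_⟩
  · rw [add_dotProduct, smul_dotProduct, smul_dotProduct, hx.1 i hi, hy.1 i hi, hr i]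
    simp only [smul_eq_mul]
    linear_combination (s * r i + t * r i) * hst
  · obtain ⟨x1, x2⟩ := hx.2 i hi
    obtain ⟨y1, y2⟩ := hy.2 i hi
    have hne := hu.2 i hi
    rw [add_dotProduct, smul_dotProduct, smul_dotProduct, smul_eq_mul, smul_eq_mul]
    have hconv := convex_Iio (𝕜 := ℝ) (r i)
    have hconv' := convex_Ioi (𝕜 := ℝ) (r i)
    rcases lt_or_gt_of_ne hne with h | h
    · have : s * (x ⬝ᵥ toR d (b i)) + t * (y ⬝ᵥ toR d (b i)) < r i :=
        hconv (x1.2 h) (y1.2 h) hs ht hst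
      exact ⟨iff_of_true this h, iff_of_false this.ne hne⟩
    · have hx' : r i < x ⬝ᵥ toR d (b i) :=
        lt_of_le_of_ne (not_lt.1 fun h' => (x1.1 h').not_gt h) fun h' => hne (x2.1 h'.symm)
      have hy' : r i < y ⬝ᵥ toR d (b i) :=
        lt_of_le_of_ne (not_lt.1 fun h' => (y1.1 h').not_gt h) fun h' => hne (y2.1 h'.symm)
      have : r i < s * (x ⬝ᵥ toR d (b i)) + t * (y ⬝ᵥ toR d (b i)) :=
        hconv' hx' hy' hs ht hst
      exact ⟨iff_of_false this.not_gt h.not_gt, iff_of_false this.ne' hne⟩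

theorem mem_cellOf_self {F : Finset (Fin n)} {u : Fin d → ℝ}
    (hu : u ∈ arrComplement d n b r F) : u ∈ cellOf d n b r F u :=
  mem_cellOf.2 ⟨(mem_arrComplement.1 hu).1, fun _ _ => ⟨Iff.rfl, Iff.rfl⟩⟩

/-- The regions of `H^F` are its full-dimensional cells. -/
theorem connectedComponentIn_arrComplement {F : Finset (Fin n)} {u : Fin d → ℝ}
    (hu : u ∈ arrComplement d n b r F) :
    connectedComponentIn (arrComplement d n b r F) u = cellOf d n b r F u := by
  apply Set.Subset.antisymm
  · intro v hv
    have hvA := connectedComponentIn_subset _ _ hv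
    rw [mem_cellOf]
    refine ⟨(mem_arrComplement.1 hvA).1, fun i hi => ?_⟩
    have hcont : Continuous fun w : Fin d → ℝ => w ⬝ᵥ toR d (b i) := by
      unfold dotProduct; fun_prop
    have hne : ∀ w ∈ connectedComponentIn (arrComplement d n b r F) u,
        w ⬝ᵥ toR d (b i) ≠ r i := fun w hw =>
      (mem_arrComplement.1 (connectedComponentIn_subset _ _ hw)).2 i hi
    have hord := (isPreconnected_connectedComponentIn.image _
      hcont.continuousOn : IsPreconnected ((fun w : Fin d → ℝ => w ⬝ᵥ toR d (b i)) ''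
        connectedComponentIn (arrComplement d n b r F) u)).ordConnected
    have hno : r i ∉ (fun w : Fin d → ℝ => w ⬝ᵥ toR d (b i)) ''
        connectedComponentIn (arrComplement d n b r F) u := by
      rintro ⟨w, hw, hwr⟩
      exact hne w hw hwr
    have huC := mem_connectedComponentIn hu
    refine ⟨⟨fun h => ?_, fun h => ?_⟩, iff_of_false (hne v hv) (hne u huC)⟩
    · by_contra h'
      exact hno (hord.out ⟨v, hv, rfl⟩ ⟨u, huC, rfl⟩ ⟨h.le, not_lt.1 h'⟩)
    · by_contra h'
      exact hno (hord.out ⟨u, huC, rfl⟩ ⟨v, hv, rfl⟩ ⟨h.le, not_lt.1 h'⟩)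
  · refine (convex_cellOf F u hu).isPreconnected.subset_connectedComponentIn
      (mem_cellOf_self hu) fun v hv => ?_
    rw [mem_cellOf] at hv
    exact mem_arrComplement.2 ⟨hv.1, fun i hi h =>
      (mem_arrComplement.1 hu).2 i hi ((hv.2 i hi).2.1 h)⟩

/-- A bounded region has no nonzero recession direction. -/
theorem eq_zero_of_isBounded_cellOf {F : Finset (Fin n)} {u : Fin d → ℝ}
    (hu : u ∈ arrComplement d n b r F) (hbd : Bornology.IsBounded (cellOf d n b r F u))
    (v : Fin d → ℝ) (hv : ∀ i, (u ⬝ᵥ toR d (b i) = r i → v ⬝ᵥ toR d (b i) = 0) ∧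
      (r i < u ⬝ᵥ toR d (b i) → 0 ≤ v ⬝ᵥ toR d (b i)) ∧
      (u ⬝ᵥ toR d (b i) < r i → v ⬝ᵥ toR d (b i) ≤ 0)) : v = 0 := by
  have hray : ∀ t : ℝ, 0 ≤ t → u + t • v ∈ cellOf d n b r F u := by
    intro t ht
    rw [mem_cellOf]
    have hu' := mem_arrComplement.1 hu
    refine ⟨fun i hi => ?_, fun i hi => ?_⟩
    · rw [add_dotProduct, smul_dotProduct, (hv i).1 (hu'.1 i hi), hu'.1 i hi, smul_zero,
        add_zero]
    · rw [add_dotProduct, smul_dotProduct, smul_eq_mul]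
      rcases lt_or_gt_of_ne (hu'.2 i hi) with h | h
      · have := mul_nonpos_of_nonneg_of_nonpos ht ((hv i).2.2 h)
        exact ⟨iff_of_true (by linarith) h, iff_of_false (by linarith) h.ne⟩
      · have := mul_nonneg ht ((hv i).2.1 h)
        exact ⟨iff_of_false (by linarith) h.not_gt, iff_of_false (by linarith) h.ne'⟩
  obtain ⟨C, hC⟩ := hbd.exists_norm_le
  by_contra hne
  have hpos : 0 < ‖v‖ := norm_pos_iff.2 hne
  have hC0 : 0 ≤ C := (norm_nonneg _).trans (hC _ (hray 0 le_rfl))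
  have ht : 0 ≤ (C + ‖u‖ + 1) / ‖v‖ := by positivity
  have h1 := hC _ (hray _ ht)
  have h2 : ‖((C + ‖u‖ + 1) / ‖v‖) • v‖ = C + ‖u‖ + 1 := by
    rw [norm_smul, Real.norm_of_nonneg ht, div_mul_cancel₀ _ hpos.ne']
  have h3 := norm_sub_le (u + ((C + ‖u‖ + 1) / ‖v‖) • v) u
  rw [add_sub_cancel_left, h2] at h3
  linarith

end Arrangement

section Lawrence

variable {d n : ℕ} {b : Fin n → Fin d → ℤ}

theorem exists_coordinates (hgen : Submodule.span ℤ (Set.range b) = ⊤) :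
    ∃ k : (Fin d → ℝ) →ₗ[ℝ] (Fin n → ℝ), ∀ x, ∑ i, k x i • toR d (b i) = x := by
  have hK : ∀ j : Fin d, ∃ c : Fin n → ℤ, ∑ i, c i • b i = Pi.single j 1 := fun j =>
    (Submodule.mem_span_range_iff_exists_fun ℤ).1 (hgen ▸ Submodule.mem_top)
  choose K hK using hK
  refine ⟨Matrix.vecMulLinear (Matrix.of fun j i => (K j i : ℝ)), fun x => ?_⟩
  ext m
  have hKm : ∀ j, ∑ i, (K j i : ℝ) * (b i m : ℝ) = if m = j then 1 else 0 := fun j => by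
    have := congrArg (fun y : Fin d → ℤ => (y m : ℝ)) (hK j)
    simpa [Pi.single_apply] using this
  simp only [Matrix.vecMulLinear_apply, Matrix.vecMul, dotProduct, Matrix.of_apply, toR,
    Finset.sum_apply, Pi.smul_apply, smul_eq_mul, Finset.sum_mul]
  rw [Finset.sum_comm]
  simp only [mul_assoc, ← Finset.mul_sum, hKm]
  simp

theorem span_toR_eq_top (hgen : Submodule.span ℤ (Set.range b) = ⊤) :
    Submodule.span ℝ (Set.range fun i => toR d (b i)) = ⊤ := by
  obtain ⟨k, hk⟩ := exists_coordinates hgen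
  refine eq_top_iff.2 fun x _ => ?_
  exact (Submodule.mem_span_range_iff_exists_fun ℝ).2 ⟨k x, hk x⟩

theorem eq_zero_of_dotProduct_toR (hgen : Submodule.span ℤ (Set.range b) = ⊤)
    (v : Fin d → ℝ) (hv : ∀ i, v ⬝ᵥ toR d (b i) = 0) : v = 0 := by
  obtain ⟨k, hk⟩ := exists_coordinates hgen
  refine dotProduct_eq_zero v fun w => ?_
  rw [← hk w, dotProduct_sum]
  exact Finset.sum_eq_zero fun i _ => by rw [dotProduct_smul, hv i, smul_zero]

theorem mem_lawrencePolytope {z : (Fin d → ℝ) × (Fin n → ℝ)} :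
    z ∈ lawrencePolytope d n b ↔ ∃ l k : Fin n → ℝ, (∀ i, 0 ≤ l i) ∧ (∀ i, 0 ≤ k i) ∧
      ∑ i, (l i + k i) = 1 ∧ z = (∑ i, l i • toR d (b i), l + k) := by
  constructor
  · intro hz
    refine convexHull_min (t := {z | ∃ l k : Fin n → ℝ, (∀ i, 0 ≤ l i) ∧ (∀ i, 0 ≤ k i) ∧
      ∑ i, (l i + k i) = 1 ∧ z = (∑ i, l i • toR d (b i), l + k)}) ?_ ?_ hz
    · have hsingle : ∀ i j : Fin n, 0 ≤ (Pi.single i 1 : Fin n → ℝ) j := fun i j => by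
        rw [Pi.single_apply]; split_ifs <;> norm_num
      rintro _ (⟨i, rfl⟩ | ⟨i, rfl⟩)
      · exact ⟨Pi.single i 1, 0, hsingle i, fun _ => le_rfl, by simp,
          by simp [Pi.single_apply, e]⟩
      · exact ⟨0, Pi.single i 1, fun _ => le_rfl, hsingle i, by simp, by simp [e]⟩
    · rintro _ ⟨l, k, hl, hk, hs, rfl⟩ _ ⟨l', k', hl', hk', hs', rfl⟩ s t hs0 ht0 hst
      refine ⟨s • l + t • l', s • k + t • k', fun i => ?_, fun i => ?_, ?_, ?_⟩
      · exact add_nonneg (mul_nonneg hs0 (hl i)) (mul_nonneg ht0 (hl' i))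
      · exact add_nonneg (mul_nonneg hs0 (hk i)) (mul_nonneg ht0 (hk' i))
      · calc _ = s * ∑ i, (l i + k i) + t * ∑ i, (l' i + k' i) := by
              rw [Finset.mul_sum, Finset.mul_sum, ← Finset.sum_add_distrib]
              refine Finset.sum_congr rfl fun i _ => ?_
              simp only [Pi.add_apply, Pi.smul_apply, smul_eq_mul]
              ring
          _ = 1 := by rw [hs, hs', mul_one, mul_one, hst]
      · ext1
        · simp only [Prod.fst_add, Prod.smul_fst, Finset.smul_sum, Pi.add_apply, Pi.smul_apply,
            add_smul, Finset.sum_add_distrib, smul_assoc]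
        · simp only [Prod.snd_add, Prod.smul_snd, smul_add]
          abel
  · rintro ⟨l, k, hl, hk, hs, rfl⟩
    have hmem : ∀ p : Fin n ⊕ Fin n, Sum.elim (fun i => (toR d (b i), e n i))
        (fun i => ((0 : Fin d → ℝ), e n i)) p ∈ lawrencePolytope d n b := by
      intro p
      refine subset_convexHull ℝ _ ?_
      rcases p with i | i
      · exact Or.inl ⟨i, rfl⟩
      · exact Or.inr ⟨i, rfl⟩
    have hsum := (convex_convexHull ℝ _ : Convex ℝ (lawrencePolytope d n b)).sum_mem
      (t := Finset.univ) (w := Sum.elim l k) (fun p _ => by rcases p with i | i <;> simp [hl, hk])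
      (by simpa [Finset.sum_add_distrib] using hs) (fun p _ => hmem p)
    refine (congrArg (· ∈ lawrencePolytope d n b) ?_).mpr hsum
    rw [Fintype.sum_sum_type]
    ext1
    · simp [Prod.fst_sum]
    · ext j
      simp [Prod.snd_sum, e, Pi.single_apply]

theorem mem_smul_lawrencePolytope {m : ℝ} (hm : 0 < m) {z : (Fin d → ℝ) × (Fin n → ℝ)} :
    z ∈ m • lawrencePolytope d n b ↔ ∃ l k : Fin n → ℝ, (∀ i, 0 ≤ l i) ∧ (∀ i, 0 ≤ k i) ∧
      ∑ i, (l i + k i) = m ∧ z = (∑ i, l i • toR d (b i), l + k) := by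
  rw [Set.mem_smul_set]
  constructor
  · rintro ⟨y, hy, rfl⟩
    obtain ⟨l, k, hl, hk, hs, rfl⟩ := mem_lawrencePolytope.1 hy
    refine ⟨m • l, m • k, fun i => mul_nonneg hm.le (hl i), fun i => mul_nonneg hm.le (hk i),
      ?_, ?_⟩
    · simp only [Pi.smul_apply, smul_eq_mul, ← mul_add, ← Finset.mul_sum, hs, mul_one]
    · ext1
      · simp only [Prod.smul_fst, Finset.smul_sum, Pi.smul_apply, smul_assoc]
      · simp only [Prod.smul_snd, smul_add]
  · rintro ⟨l, k, hl, hk, hs, rfl⟩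
    refine ⟨m⁻¹ • (∑ i, l i • toR d (b i), l + k), mem_lawrencePolytope.2 ⟨m⁻¹ • l, m⁻¹ • k,
      fun i => mul_nonneg (inv_nonneg.2 hm.le) (hl i),
      fun i => mul_nonneg (inv_nonneg.2 hm.le) (hk i), ?_, ?_⟩, smul_inv_smul₀ hm.ne' _⟩
    · simp only [Pi.smul_apply, smul_eq_mul, ← mul_add, ← Finset.mul_sum, hs]
      exact inv_mul_cancel₀ hm.ne'
    · ext1
      · simp only [Prod.smul_fst, Finset.smul_sum, Pi.smul_apply, smul_assoc]
      · simp only [Prod.smul_snd, smul_add]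

theorem sum_snd_of_mem_affineSpan {m : ℝ} (hm : 0 < m) {z : (Fin d → ℝ) × (Fin n → ℝ)}
    (hz : z ∈ affineSpan ℝ (m • lawrencePolytope d n b)) : ∑ i, z.2 i = m := by
  refine affineSpan_induction (p := fun z => ∑ i, z.2 i = m) hz ?_ ?_
  · intro y hy
    obtain ⟨l, k, -, -, hs, rfl⟩ := (mem_smul_lawrencePolytope hm).1 hy
    exact hs
  · intro c u v w hu hv hw
    simp only [vsub_eq_sub, vadd_eq_add, Prod.snd_add, Prod.smul_snd, Prod.snd_sub, Pi.add_apply,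
      Pi.smul_apply, Pi.sub_apply, smul_eq_mul, Finset.sum_add_distrib, ← Finset.mul_sum,
      Finset.sum_sub_distrib, hu, hv, hw]
    ring

/-- The relative interior of a dilated Lawrence polytope consists of the strictly positive
combinations of its vertices. -/
theorem mem_intrinsicInterior_smul_lawrencePolytope
    (hgen : Submodule.span ℤ (Set.range b) = ⊤) (hn : 0 < n) {m : ℝ} (hm : 0 < m)
    {z : (Fin d → ℝ) × (Fin n → ℝ)} :
    z ∈ intrinsicInterior ℝ (m • lawrencePolytope d n b) ↔
      ∃ l k : Fin n → ℝ, (∀ i, 0 < l i) ∧ (∀ i, 0 < k i) ∧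
        ∑ i, (l i + k i) = m ∧ z = (∑ i, l i • toR d (b i), l + k) := by
  set S := m • lawrencePolytope d n b with hS
  rw [mem_intrinsicInterior]
  constructor
  · rintro ⟨y, hy, rfl⟩
    set q : ℝ := m / (2 * n) with hq
    have hn' : (0 : ℝ) < n := Nat.cast_pos.2 hn
    have hq0 : 0 < q := by positivity
    set c : (Fin d → ℝ) × (Fin n → ℝ) :=
      (∑ i, (fun _ : Fin n => q) i • toR d (b i), (fun _ => q) + fun _ => q) with hc
    have hcS : c ∈ S := (mem_smul_lawrencePolytope hm).2 ⟨fun _ => q, fun _ => q,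
      fun _ => hq0.le, fun _ => hq0.le, by simp [hq]; field_simp; norm_num, rfl⟩
    set path : ℝ → affineSpan ℝ S := fun t =>
      ⟨AffineMap.lineMap (y : (Fin d → ℝ) × (Fin n → ℝ)) c (-t),
        AffineMap.lineMap_mem _ y.2 (subset_affineSpan ℝ S hcS)⟩ with hpath
    have hcont : Continuous path := by
      refine Continuous.subtype_mk ?_ _
      exact AffineMap.lineMap_continuous.comp continuous_neg
    have h0 : path 0 = y := by
      apply Subtype.ext
      simp [hpath]
    have hev : ∀ᶠ t in nhds (0 : ℝ), path t ∈ interior ((↑) ⁻¹' S : Set (affineSpan ℝ S)) := by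
      refine hcont.continuousAt.eventually_mem ?_
      rw [h0]
      exact isOpen_interior.mem_nhds hy
    obtain ⟨t, ht, ht0⟩ := ((hev.filter_mono nhdsWithin_le_nhds).and
      (self_mem_nhdsWithin : Set.Ioi (0 : ℝ) ∈ nhdsWithin 0 (Set.Ioi 0))).exists
    have ht0 : 0 < t := ht0
    have htS : AffineMap.lineMap (y : (Fin d → ℝ) × (Fin n → ℝ)) c (-t) ∈ S :=
      (interior_subset ht : path t ∈ ((↑) ⁻¹' S : Set (affineSpan ℝ S)))
    obtain ⟨l, k, hl, hk, hs, heq⟩ := (mem_smul_lawrencePolytope hm).1 htS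
    have ht1 : 0 < 1 + t := by linarith
    have hy' : (y : (Fin d → ℝ) × (Fin n → ℝ)) =
        (1 + t)⁻¹ • ((∑ i, l i • toR d (b i), l + k) + t • c) := by
      rw [← heq, AffineMap.lineMap_apply_module, eq_inv_smul_iff₀ ht1.ne']
      module
    refine ⟨(1 + t)⁻¹ • (l + t • fun _ => q), (1 + t)⁻¹ • (k + t • fun _ => q),
      fun i => ?_, fun i => ?_, ?_, ?_⟩
    · exact mul_pos (inv_pos.2 ht1) (add_pos_of_nonneg_of_pos (hl i) (mul_pos ht0 hq0))
    · exact mul_pos (inv_pos.2 ht1) (add_pos_of_nonneg_of_pos (hk i) (mul_pos ht0 hq0))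
    · have hqs : ∑ _i : Fin n, (q + q) = m := by
        simp [hq]; field_simp; norm_num
      calc _ = (1 + t)⁻¹ * (∑ i, (l i + k i) + t * ∑ _i : Fin n, (q + q)) := by
            rw [Finset.mul_sum, ← Finset.sum_add_distrib, Finset.mul_sum]
            refine Finset.sum_congr rfl fun i _ => ?_
            simp only [Pi.add_apply, Pi.smul_apply, smul_eq_mul]
            ring
        _ = m := by rw [hs, hqs]; field_simp
    · rw [hy', hc]
      ext1
      · simp only [Prod.fst_add, Prod.smul_fst, Finset.smul_sum, Pi.add_apply, Pi.smul_apply,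
          add_smul, smul_add, Finset.sum_add_distrib, smul_assoc]
      · simp only [Prod.snd_add, Prod.smul_snd, smul_add]
        abel
  · rintro ⟨l, k, hl, hk, hs, rfl⟩
    set z : (Fin d → ℝ) × (Fin n → ℝ) := (∑ i, l i • toR d (b i), l + k) with hz
    have hzS : z ∈ S := (mem_smul_lawrencePolytope hm).2
      ⟨l, k, fun i => (hl i).le, fun i => (hk i).le, hs, rfl⟩
    refine ⟨⟨z, subset_affineSpan ℝ S hzS⟩, ?_, rfl⟩
    obtain ⟨κ, hκ⟩ := exists_coordinates hgen
    have hκc : Continuous κ := κ.continuous_of_finiteDimensional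
    have hopen : IsOpen (⋂ i, {w : affineSpan ℝ S | 0 < l i + κ (w.1.1 - z.1) i ∧
        0 < w.1.2 i - (l i + κ (w.1.1 - z.1) i)}) := by
      refine isOpen_iInter_of_finite fun i => ?_
      have h1 : Continuous fun w : affineSpan ℝ S => l i + κ (w.1.1 - z.1) i := by
        have : Continuous fun w : affineSpan ℝ S => κ (w.1.1 - z.1) := by fun_prop
        exact continuous_const.add ((continuous_apply i).comp this)
      have h2 : Continuous fun w : affineSpan ℝ S => w.1.2 i := by fun_prop
      exact (isOpen_lt continuous_const h1).inter (isOpen_lt continuous_const (h2.sub h1))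
    refine mem_interior.2 ⟨_, ?_, hopen, ?_⟩
    · intro w hw
      rw [Set.mem_iInter] at hw
      refine (mem_smul_lawrencePolytope hm).2 ⟨l + κ (w.1.1 - z.1),
        w.1.2 - (l + κ (w.1.1 - z.1)), fun i => (hw i).1.le, fun i => (hw i).2.le, ?_, ?_⟩
      · rw [← sum_snd_of_mem_affineSpan hm w.2]
        refine Finset.sum_congr rfl fun i _ => ?_
        simp
      · ext1
        · simp only [Pi.add_apply, add_smul, Finset.sum_add_distrib, hκ, hz]
          abel
        · simp
    · rw [Set.mem_iInter]
      intro i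
      simp [hz, hl i, hk i]

end Lawrence

section Counting

variable {d n : ℕ} {b : Fin n → Fin d → ℤ} {r : Fin n → ℝ}

theorem toR_add_sum (z : Fin d → ℤ) (s : Finset (Fin n)) :
    toR d (z + ∑ i ∈ s, b i) = toR d z + ∑ i ∈ s, toR d (b i) := by
  ext j
  simp [toR]

/-- The lattice points of the open zonotope `{∑ l i • b i : 0 < l i < 1}`. -/
def openZonotopePoints (d n : ℕ) (b : Fin n → Fin d → ℤ) : Set (Fin d → ℤ) :=
  {x | ∃ l : Fin n → ℝ, (∀ i, 0 < l i ∧ l i < 1) ∧ ∑ i, l i • toR d (b i) = toR d x}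

/-- The bounded regions of the restricted arrangement `H^F`. -/
def boundedRegions (d n : ℕ) (b : Fin n → Fin d → ℤ) (r : Fin n → ℝ) (F : Finset (Fin n)) :
    Set (Set (Fin d → ℝ)) :=
  {R | (∃ x ∈ arrComplement d n b r F, R = connectedComponentIn (arrComplement d n b r F) x) ∧
    Bornology.IsBounded R}

theorem finite_openZonotopePoints : (openZonotopePoints d n b).Finite := by
  refine (Set.finite_Icc (fun j => -∑ i, |b i j|) (fun j => ∑ i, |b i j|)).subset ?_
  rintro x ⟨l, hl, hx⟩
  have habs : ∀ j, |x j| ≤ ∑ i, |b i j| := by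
    intro j
    have hxj : (x j : ℝ) = ∑ i, l i * (b i j : ℝ) := by
      have := congrFun hx j
      simpa [toR] using this.symm
    have : |(x j : ℝ)| ≤ ∑ i, |(b i j : ℝ)| := by
      rw [hxj]
      refine (Finset.abs_sum_le_sum_abs _ _).trans (Finset.sum_le_sum fun i _ => ?_)
      rw [abs_mul, abs_of_pos (hl i).1]
      exact mul_le_of_le_one_left (abs_nonneg _) (hl i).2.le
    exact_mod_cast this
  exact ⟨fun j => (abs_le.1 (habs j)).1, fun j => (abs_le.1 (habs j)).2⟩

theorem exists_tileCoeff_of_mem_box (hr : Simple d n b r) {F : Finset (Fin n)} {u : Fin d → ℝ}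
    (hu : u ∈ arrComplement d n b r F) {z : Fin d → ℤ} (hz : toR d z ∈ box d n b F) :
    ∃ c, TileCoeff (fun i => toR d (b i)) r u c ∧ ∑ i, c i • toR d (b i) =
      toR d (z + ∑ i with r i < u ⬝ᵥ toR d (b i), b i) := by
  obtain ⟨α, hα, hzα⟩ := hz
  have hF := hr.mem_iff_of_mem_arrComplement hu
  refine ⟨fun i => if r i < u ⬝ᵥ toR d (b i) then 1 else if i ∈ F then α i else 0,
    fun i => ?_, ?_⟩
  · rcases lt_trichotomy (u ⬝ᵥ toR d (b i)) (r i) with h | h | h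
    · exact Or.inr (Or.inl ⟨h, by simp [h.not_gt, hF, h.ne]⟩)
    · refine Or.inr (Or.inr ⟨h, ?_⟩)
      have hi := (hF i).2 h
      simpa [h, hi] using hα i hi
    · exact Or.inl ⟨h, by simp [h]⟩
  · have hsum : ∑ i ∈ F, α i • toR d (b i) = ∑ i, if i ∈ F then α i • toR d (b i) else 0 := by
      simp
    rw [toR_add_sum, hzα, hsum, Finset.sum_filter, ← Finset.sum_add_distrib]
    refine Finset.sum_congr rfl fun i _ => ?_
    rcases lt_trichotomy (u ⬝ᵥ toR d (b i)) (r i) with h | h | h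
    · simp [h.not_gt, hF, h.ne]
    · simp [hF, h]
    · simp [h, hF, h.ne']

theorem mem_openZonotopePoints_of_mem_box (hgen : Submodule.span ℤ (Set.range b) = ⊤)
    (hr : Simple d n b r) {F : Finset (Fin n)} {u : Fin d → ℝ}
    (hu : u ∈ arrComplement d n b r F)
    (hbd : Bornology.IsBounded (connectedComponentIn (arrComplement d n b r F) u))
    {z : Fin d → ℤ} (hz : toR d z ∈ box d n b F) :
    z + ∑ i with r i < u ⬝ᵥ toR d (b i), b i ∈ openZonotopePoints d n b := by
  obtain ⟨c, hc, hcx⟩ := exists_tileCoeff_of_mem_box hr hu hz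
  rw [connectedComponentIn_arrComplement hu] at hbd
  obtain ⟨l, hl, hlx⟩ := hc.exists_open_coeff (span_toR_eq_top hgen)
    (eq_zero_of_isBounded_cellOf hu hbd)
  exact ⟨l, hl, hlx.trans hcx⟩

theorem exists_mem_box_of_mem_openZonotopePoints (hgen : Submodule.span ℤ (Set.range b) = ⊤)
    (hr : Simple d n b r) {x : Fin d → ℤ} (hx : x ∈ openZonotopePoints d n b) :
    ∃ (F : Finset (Fin n)) (u : Fin d → ℝ) (z : Fin d → ℤ), u ∈ arrComplement d n b r F ∧
      Bornology.IsBounded (connectedComponentIn (arrComplement d n b r F) u) ∧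
      toR d z ∈ box d n b F ∧ z + ∑ i with r i < u ⬝ᵥ toR d (b i), b i = x := by
  obtain ⟨l, hl, hlx⟩ := hx
  obtain ⟨u, c, hc, hcx, hbd⟩ := exists_tileCoeff (a := fun i => toR d (b i)) (r := r)
    (eq_zero_of_dotProduct_toR hgen) (fun u i hi => by
      obtain ⟨v, hv⟩ := hr.exists_dual u (Pi.single i 1)
      exact ⟨v, by simp [hv i hi], fun j hj hju => by simp [hv j hju, hj]⟩) hl
  set F : Finset (Fin n) := {i | u ⬝ᵥ toR d (b i) = r i} with hF
  have hu : u ∈ arrComplement d n b r F := by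
    refine mem_arrComplement.2 ⟨fun i hi => by simpa [hF] using hi, fun i hi h => ?_⟩
    exact hi (toR_mem_spanF (by simpa [hF] using h))
  refine ⟨F, u, x - ∑ i with r i < u ⬝ᵥ toR d (b i), b i, hu, ?_, ⟨c, fun i hi => ?_, ?_⟩,
    sub_add_cancel _ _⟩
  · rw [connectedComponentIn_arrComplement hu]
    refine hbd.subset fun w hw i => ?_
    obtain ⟨h1, h2⟩ := sign_eq_of_mem_cellOf (mem_arrComplement.1 hu).1 hw i
    rcases hc i with ⟨h, hci⟩ | ⟨h, hci⟩ | ⟨h, hci⟩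
    · exact Or.inl ⟨lt_of_le_of_ne (not_lt.1 fun h' => (h1.1 h').not_gt h)
        fun h' => h.ne' (h2.1 h'.symm), hci⟩
    · exact Or.inr (Or.inl ⟨h1.2 h, hci⟩)
    · exact Or.inr (Or.inr ⟨h2.2 h, hci⟩)
  · have hi : u ⬝ᵥ toR d (b i) = r i := by simpa [hF] using hi
    rcases hc i with ⟨h, -⟩ | ⟨h, -⟩ | ⟨-, hci⟩
    · exact absurd hi h.ne'
    · exact absurd hi h.ne
    · exact hci
  · have hadd := toR_add_sum (b := b) (x - ∑ i with r i < u ⬝ᵥ toR d (b i), b i)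
      {i | r i < u ⬝ᵥ toR d (b i)}
    rw [sub_add_cancel, ← hlx, ← hcx] at hadd
    rw [eq_sub_of_add_eq hadd.symm, sub_eq_iff_eq_add, hF, Finset.sum_filter, Finset.sum_filter,
      ← Finset.sum_add_distrib]
    refine Finset.sum_congr rfl fun i _ => ?_
    rcases hc i with ⟨h, hci⟩ | ⟨h, hci⟩ | ⟨h, hci⟩
    · simp [h, h.ne', hci]
    · simp [h.not_gt, h.ne, hci]
    · simp [h]

theorem eq_of_box_translate_eq (hr : Simple d n b r) {F F' : Finset (Fin n)}
    {u u' : Fin d → ℝ} (hu : u ∈ arrComplement d n b r F) (hu' : u' ∈ arrComplement d n b r F')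
    {z z' : Fin d → ℤ} (hz : toR d z ∈ box d n b F) (hz' : toR d z' ∈ box d n b F')
    (h : z + ∑ i with r i < u ⬝ᵥ toR d (b i), b i = z' + ∑ i with r i < u' ⬝ᵥ toR d (b i), b i) :
    F = F' ∧ z = z' ∧ cellOf d n b r F u = cellOf d n b r F' u' := by
  obtain ⟨c, hc, hcx⟩ := exists_tileCoeff_of_mem_box hr hu hz
  obtain ⟨c', hc', hcx'⟩ := exists_tileCoeff_of_mem_box hr hu' hz'
  have hsign := hc.sign_eq hc' (hcx.trans ((congrArg _ h).trans hcx'.symm))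
  have hFF : F = F' := by
    ext i
    rw [hr.mem_iff_of_mem_arrComplement hu, hr.mem_iff_of_mem_arrComplement hu', (hsign i).2]
  have hlt : ∀ i, u ⬝ᵥ toR d (b i) < r i ↔ u' ⬝ᵥ toR d (b i) < r i := fun i => by
    rw [← not_le, ← not_le, le_iff_lt_or_eq, le_iff_lt_or_eq, (hsign i).1, eq_comm, (hsign i).2,
      eq_comm]
  subst hFF
  refine ⟨rfl, ?_, ?_⟩
  · simp only [(hsign _).1] at h
    exact add_right_cancel h
  · ext v
    rw [mem_cellOf, mem_cellOf]
    simp only [hlt, (hsign _).2]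

theorem boundedRegions_eq_empty (hr : Simple d n b r) {F : Finset (Fin n)}
    (hF : ¬ memMatroid d n b F) : boundedRegions d n b r F = ∅ := by
  refine Set.eq_empty_of_forall_notMem ?_
  rintro R ⟨⟨x, hx, -⟩, -⟩
  exact hF (hr.memMatroid_of_mem_flat (mem_arrComplement.1 hx).1)

/-- The lattice points of the open zonotope are counted by the open tiles dual to the bounded
cells of a simple arrangement. -/
theorem card_openZonotopePoints (hgen : Submodule.span ℤ (Set.range b) = ⊤)
    (hr : Simple d n b r) : Nat.card (openZonotopePoints d n b) =
      ∑ F : Finset (Fin n), boxCount d n b F * boundedRegionCount d n b r F := by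
  have hpt : ∀ (F : Finset (Fin n)) (R : boundedRegions d n b r F),
      ∃ x ∈ arrComplement d n b r F, R.1 = connectedComponentIn (arrComplement d n b r F) x :=
    fun F R => R.2.1
  choose pt hptA hptR using hpt
  let Tile (F : Finset (Fin n)) := {z : Fin d → ℤ | toR d z ∈ box d n b F} ×
    boundedRegions d n b r F
  let Φ : (Σ F, Tile F) → openZonotopePoints d n b := fun p =>
    ⟨p.2.1.1 + ∑ i with r i < pt p.1 p.2.2 ⬝ᵥ toR d (b i), b i,
      mem_openZonotopePoints_of_mem_box hgen hr (hptA _ _) (hptR p.1 p.2.2 ▸ p.2.2.2.2) p.2.1.2⟩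
  have hinj : Function.Injective Φ := by
    rintro ⟨F, z, R⟩ ⟨F', z', R'⟩ h
    obtain ⟨hF, hz, hR⟩ := eq_of_box_translate_eq hr (hptA F R) (hptA F' R') z.2 z'.2
      (congrArg Subtype.val h)
    subst hF
    rw [← connectedComponentIn_arrComplement (hptA F R),
      ← connectedComponentIn_arrComplement (hptA F R'), ← hptR, ← hptR] at hR
    rw [Subtype.ext hz, Subtype.ext hR]
  have hsurj : Function.Surjective Φ := by
    rintro ⟨x, hx⟩
    obtain ⟨F, u, z, hu, hbd, hz, rfl⟩ := exists_mem_box_of_mem_openZonotopePoints hgen hr hx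
    refine ⟨⟨F, ⟨z, hz⟩, ⟨_, ⟨u, hu, rfl⟩, hbd⟩⟩, Subtype.ext ?_⟩
    set R : boundedRegions d n b r F := ⟨_, ⟨u, hu, rfl⟩, hbd⟩ with hR
    have hmem : u ∈ cellOf d n b r F (pt F R) := by
      rw [← connectedComponentIn_arrComplement (hptA F R), ← hptR F R]
      exact mem_connectedComponentIn hu
    have hsign := sign_eq_of_mem_cellOf (mem_arrComplement.1 (hptA F R)).1 hmem
    have hpos : ∀ i, r i < pt F R ⬝ᵥ toR d (b i) ↔ r i < u ⬝ᵥ toR d (b i) := fun i => by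
      rw [← not_le, ← not_le, le_iff_lt_or_eq, le_iff_lt_or_eq, (hsign i).1, (hsign i).2]
    simp only [Φ, hpos]
  have : Finite (openZonotopePoints d n b) := finite_openZonotopePoints
  have : Finite (Σ F, Tile F) := Finite.of_injective Φ hinj
  have hfin : ∀ F, Finite (Tile F) := fun F => Finite.of_injective (Sigma.mk F) sigma_mk_injective
  rw [← Nat.card_eq_of_bijective Φ ⟨hinj, hsurj⟩, Nat.card_sigma]
  exact Finset.sum_congr rfl fun F _ => Nat.card_prod _ _

/-- In degrees at most `n`, lattice points in the relative interior of the dilated Lawrence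
polytope exist only in degree `n`, where they correspond to those of the open zonotope. -/
theorem lattice_mem_intrinsicInterior_iff (hgen : Submodule.span ℤ (Set.range b) = ⊤)
    (hn : 0 < n) {m : ℕ} (hm : 1 ≤ m) (hmn : m ≤ n) (z : (Fin d → ℤ) × (Fin n → ℤ)) :
    (toR d z.1, fun j => (z.2 j : ℝ)) ∈ intrinsicInterior ℝ ((m : ℝ) • lawrencePolytope d n b) ↔
      m = n ∧ z.1 ∈ openZonotopePoints d n b ∧ z.2 = 1 := by
  rw [mem_intrinsicInterior_smul_lawrencePolytope hgen hn (Nat.cast_pos.2 hm)]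
  constructor
  · rintro ⟨l, k, hl, hk, hs, hz⟩
    obtain ⟨hz1, hz2⟩ := Prod.ext_iff.1 hz
    have hzi : ∀ i, (z.2 i : ℝ) = l i + k i := fun i => congrFun hz2 i
    have hone : ∀ i ∈ Finset.univ, 1 ≤ z.2 i := fun i _ => by
      have : (0 : ℝ) < z.2 i := by rw [hzi]; exact add_pos (hl i) (hk i)
      exact_mod_cast this
    have hsum : ∑ i, z.2 i = m := by
      have : ∑ i, (z.2 i : ℝ) = m := by simp only [hzi, hs]
      exact_mod_cast this
    have hle := Finset.sum_le_sum hone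
    rw [hsum] at hle
    have hmn' : m = n := by
      simp at hle
      omega
    have hz2' : z.2 = 1 := by
      have heq := (Finset.sum_eq_sum_iff_of_le hone).1 (by rw [hsum, hmn']; simp)
      ext i
      exact (heq i (Finset.mem_univ i)).symm
    refine ⟨hmn', ⟨l, fun i => ⟨hl i, ?_⟩, hz1.symm⟩, hz2'⟩
    have h1 := hzi i
    rw [hz2'] at h1
    simp only [Pi.one_apply, Int.cast_one] at h1
    linarith [hk i]
  · rintro ⟨rfl, ⟨l, hl, hlx⟩, hz2⟩
    refine ⟨l, 1 - l, fun i => (hl i).1, fun i => sub_pos.2 (hl i).2, by simp, ?_⟩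
    rw [hlx, hz2]
    ext1
    · rfl
    · ext j; simp

end Counting

/-- `mP_B` has no interior lattice points for `1 ≤ m ≤ n-1`, and `nP_B` has
exactly `Σ_{F ∈ M_B} #(BOX(F) ∩ ℤ^d) R^bd_F` interior lattice points. -/
theorem statement12 (d n : ℕ) (hd : 0 < d) (hn : 0 < n)
    (b : Fin n → Fin d → ℤ) (hb : ∀ i, b i ≠ 0)
    (hgen : Submodule.span ℤ (Set.range b) = ⊤)
    (r : Fin n → ℝ) (hr : Simple d n b r) :
    (∀ m : ℕ, 1 ≤ m → m ≤ n - 1 →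
      {z : (Fin d → ℤ) × (Fin n → ℤ) |
        (toR d z.1, fun j => (z.2 j : ℝ)) ∈
          intrinsicInterior ℝ ((m : ℝ) • lawrencePolytope d n b)} = ∅) ∧
    Nat.card {z : (Fin d → ℤ) × (Fin n → ℤ) |
        (toR d z.1, fun j => (z.2 j : ℝ)) ∈
          intrinsicInterior ℝ ((n : ℝ) • lawrencePolytope d n b)}
      = ∑ F : Finset (Fin n),
          if memMatroid d n b F then boxCount d n b F * boundedRegionCount d n b r F
          else 0 := by
  refine ⟨fun m h1 hm => ?_, ?_⟩
  · refine Set.eq_empty_of_forall_notMem fun z hz => ?_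
    have := ((lattice_mem_intrinsicInterior_iff hgen hn h1 (by omega) z).1 hz).1
    omega
  · have hset : {z : (Fin d → ℤ) × (Fin n → ℤ) | (toR d z.1, fun j => (z.2 j : ℝ)) ∈
        intrinsicInterior ℝ ((n : ℝ) • lawrencePolytope d n b)} =
        openZonotopePoints d n b ×ˢ {1} := by
      ext z
      rw [Set.mem_ofPred_eq, lattice_mem_intrinsicInterior_iff hgen hn hn le_rfl]
      simp
    rw [hset, Nat.card_congr (Equiv.Set.prod _ _), Nat.card_prod, card_openZonotopePoints hgen hr,
      Nat.card_unique (α := ({1} : Set (Fin n → ℤ))), mul_one]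
    refine Finset.sum_congr rfl fun F _ => ?_
    split_ifs with hF
    · rfl
    · have : boundedRegionCount d n b r F = 0 :=
        (congrArg (fun s : Set (Set (Fin d → ℝ)) => Nat.card s)
          (boundedRegions_eq_empty hr hF)).trans (by simp)
      rw [this, mul_zero]

end LawrencePaper
end
end

section
/- Suppose the real numbers r_1, …, r_n are chosen so that the hyperplane arrangement H is simple. Let G ∈ M_B and let I be a subset of {i : b_i ∉ Span G}. Then the number of regions of the arrangement consisting of the hyperplanes H_i ∩ A_G, i ∈ I, within the affine subspace A_G equals the number of elements G' ∈ M_B satisfying G ⊆ G' ⊆ G ∪ {b_i : i ∈ I}. -/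
open scoped BigOperators Pointwise
open Polynomial

noncomputable section

namespace LawrencePaper

attribute [local instance] Classical.propDecidable

/-- The affine functional `u ↦ ⟨u, b_i⟩ - r_i` defining the hyperplane `H_i`. -/
def defect (d n : ℕ) (b : Fin n → Fin d → ℤ) (r : Fin n → ℝ) (i : Fin n) (u : Fin d → ℝ) : ℝ :=
  ∑ j, u j * (b i j : ℝ) - r i

/-- The points of `A_G` lying on the positive side of `H_j` for `j ∈ I ∩ P` and on the negative
side for `j ∈ I \ P`. -/
def signCell (d n : ℕ) (b : Fin n → Fin d → ℤ) (r : Fin n → ℝ) (G I P : Finset (Fin n)) :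
    Set (Fin d → ℝ) :=
  {x ∈ flat d n b r G | ∀ j ∈ I,
    (j ∈ P → 0 < defect d n b r j x) ∧ (j ∉ P → defect d n b r j x < 0)}

/-- The sign patterns on `I` realized by points of `A_G`. -/
def patterns (d n : ℕ) (b : Fin n → Fin d → ℤ) (r : Fin n → ℝ) (G I : Finset (Fin n)) :
    Finset (Finset (Fin n)) :=
  I.powerset.filter fun P => (signCell d n b r G I P).Nonempty

/-- The independent sets between `G` and `G ∪ I`. -/
def indepBetween (d n : ℕ) (b : Fin n → Fin d → ℤ) (G I : Finset (Fin n)) :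
    Finset (Finset (Fin n)) :=
  Finset.univ.filter fun G' => memMatroid d n b G' ∧ G ⊆ G' ∧ G' ⊆ G ∪ I

section

variable {d n : ℕ} {b : Fin n → Fin d → ℤ} {r : Fin n → ℝ} {G I P : Finset (Fin n)} {i : Fin n}

lemma mem_hyperplane_iff {u : Fin d → ℝ} : u ∈ hyperplane d n b r i ↔ defect d n b r i u = 0 :=
  sub_eq_zero.symm

lemma mem_flat_iff {u : Fin d → ℝ} : u ∈ flat d n b r G ↔ ∀ i ∈ G, defect d n b r i u = 0 := by
  simp only [flat, Set.mem_iInter, mem_hyperplane_iff]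

lemma continuous_defect : Continuous (defect d n b r i) := by
  unfold defect; fun_prop

lemma defect_add_smul (x v : Fin d → ℝ) (t : ℝ) :
    defect d n b r i (x + t • v) = defect d n b r i x + t * ∑ j, v j * (b i j : ℝ) := by
  simp only [defect, Pi.add_apply, Pi.smul_apply, smul_eq_mul, add_mul, Finset.sum_add_distrib,
    Finset.mul_sum, mul_assoc]
  ring

lemma defect_combo (x y : Fin d → ℝ) {s t : ℝ} (h : s + t = 1) :
    defect d n b r i (s • x + t • y) = s * defect d n b r i x + t * defect d n b r i y := by
  obtain rfl : s = 1 - t := by linarith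
  simp only [defect, Pi.add_apply, Pi.smul_apply, smul_eq_mul, add_mul, Finset.sum_add_distrib,
    mul_sub, Finset.mul_sum, mul_assoc]
  ring

lemma convex_signCell : Convex ℝ (signCell d n b r G I P) := by
  intro x hx y hy s t hs ht hst
  refine ⟨mem_flat_iff.2 fun i hi => ?_, fun j hj => ⟨fun hP => ?_, fun hP => ?_⟩⟩
  · rw [defect_combo _ _ hst, mem_flat_iff.1 hx.1 i hi, mem_flat_iff.1 hy.1 i hi]; simp
  · rw [defect_combo _ _ hst]
    exact (convex_Ioi (0 : ℝ)) ((hx.2 j hj).1 hP) ((hy.2 j hj).1 hP) hs ht hst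
  · rw [defect_combo _ _ hst]
    exact (convex_Iio (0 : ℝ)) ((hx.2 j hj).2 hP) ((hy.2 j hj).2 hP) hs ht hst

/-- The matrix whose rows are the vectors indexed by `G`. -/
def rowMatrix (d n : ℕ) (b : Fin n → Fin d → ℤ) (G : Finset (Fin n)) : Matrix G (Fin d) ℝ :=
  Matrix.of fun i => toR d (b i.1)

lemma rowMatrix_mulVec (v : Fin d → ℝ) (i : G) :
    (rowMatrix d n b G).mulVec v i = ∑ j, v j * (b i j : ℝ) := by
  simp [rowMatrix, Matrix.mulVec, dotProduct, toR, mul_comm]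

lemma memMatroid_iff_rank : memMatroid d n b G ↔ (rowMatrix d n b G).rank = G.card := by
  rw [Matrix.rank_eq_finrank_span_row, memMatroid, linearIndependent_iff_card_eq_finrank_span,
    Fintype.card_coe, eq_comm]
  rfl

lemma memMatroid.exists_pairing_eq (h : memMatroid d n b G) (c : Fin n → ℝ) :
    ∃ v : Fin d → ℝ, ∀ i ∈ G, ∑ j, v j * (b i j : ℝ) = c i := by
  have hs : (rowMatrix d n b G).mulVecLin.range = ⊤ := by
    apply Submodule.eq_top_of_finrank_eq
    rw [Module.finrank_fintype_fun_eq_card, Fintype.card_coe]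
    exact memMatroid_iff_rank.1 h
  obtain ⟨v, hv⟩ := LinearMap.range_eq_top.1 hs fun i => c i
  refine ⟨v, fun i hi => ?_⟩
  rw [← rowMatrix_mulVec (G := G) v ⟨i, hi⟩]
  exact congrFun hv ⟨i, hi⟩

lemma memMatroid.flat_nonempty (h : memMatroid d n b G) : (flat d n b r G).Nonempty := by
  obtain ⟨v, hv⟩ := h.exists_pairing_eq r
  exact ⟨v, mem_flat_iff.2 fun i hi => sub_eq_zero.2 (hv i hi)⟩

lemma Simple.memMatroid_of_mem_flat_s14 (hr : Simple d n b r) {x : Fin d → ℝ}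
    (hx : x ∈ flat d n b r G) : memMatroid d n b G := by
  have hcard := ((hr G).resolve_left (Set.Nonempty.ne_empty ⟨x, hx⟩)) x hx
  have himage : (fun u => u - x) '' (⋂ i ∈ G, hyperplane d n b r i) =
      (rowMatrix d n b G).mulVecLin.ker := by
    ext v
    have key : v ∈ (rowMatrix d n b G).mulVecLin.ker ↔ x + (1 : ℝ) • v ∈ flat d n b r G := by
      rw [LinearMap.mem_ker, Matrix.mulVecLin_apply, funext_iff, Subtype.forall, mem_flat_iff]
      refine forall₂_congr fun i hi => ?_
      rw [rowMatrix_mulVec, defect_add_smul, mem_flat_iff.1 hx i hi]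
      simp
    rw [SetLike.mem_coe, key, one_smul]
    constructor
    · rintro ⟨u, hu, rfl⟩
      simpa [flat] using hu
    · exact fun h => ⟨x + v, h, add_sub_cancel_left x v⟩
  rw [himage, Submodule.span_eq] at hcard
  have hrank := (rowMatrix d n b G).mulVecLin.finrank_range_add_finrank_ker
  rw [Module.finrank_fin_fun] at hrank
  rw [memMatroid_iff_rank, Matrix.rank]
  omega

lemma exists_signCell_both_sides (hr : Simple d n b r) (hi : i ∉ G) {x : Fin d → ℝ}
    (hx : x ∈ signCell d n b r G I P) (hxi : defect d n b r i x = 0) :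
    (∃ y ∈ signCell d n b r G I P, defect d n b r i y < 0) ∧
      ∃ z ∈ signCell d n b r G I P, 0 < defect d n b r i z := by
  have hflat : x ∈ flat d n b r (insert i G) := by
    rw [mem_flat_iff, Finset.forall_mem_insert]
    exact ⟨hxi, mem_flat_iff.1 hx.1⟩
  obtain ⟨v, hv⟩ :=
    (hr.memMatroid_of_mem_flat_s14 hflat).exists_pairing_eq (Pi.single i 1)
  have hvi : ∑ j, v j * (b i j : ℝ) = 1 := by simpa using hv i (Finset.mem_insert_self i G)
  have hmem : ∀ᶠ t : ℝ in nhds 0, x + t • v ∈ signCell d n b r G I P := by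
    have hcont (j : Fin n) : Filter.Tendsto (fun t : ℝ => defect d n b r j (x + t • v)) (nhds 0)
        (nhds (defect d n b r j x)) := by
      have : Continuous fun t : ℝ => defect d n b r j (x + t • v) :=
        continuous_defect.comp (by fun_prop)
      simpa using this.tendsto 0
    have hsign : ∀ᶠ t : ℝ in nhds 0, ∀ j ∈ I, (j ∈ P → 0 < defect d n b r j (x + t • v)) ∧
        (j ∉ P → defect d n b r j (x + t • v) < 0) := by
      rw [Filter.eventually_all_finset]
      intro j hj
      by_cases hP : j ∈ P
      · filter_upwards [(hcont j).eventually_const_lt ((hx.2 j hj).1 hP)] with t ht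
        exact ⟨fun _ => ht, fun h => absurd hP h⟩
      · filter_upwards [(hcont j).eventually_lt_const ((hx.2 j hj).2 hP)] with t ht
        exact ⟨fun h => absurd h hP, fun _ => ht⟩
    filter_upwards [hsign] with t ht
    refine ⟨mem_flat_iff.2 fun j hj => ?_, ht⟩
    have hji : j ≠ i := fun h => hi (h ▸ hj)
    rw [defect_add_smul, hv j (Finset.mem_insert_of_mem hj), mem_flat_iff.1 hx.1 j hj,
      Pi.single_eq_of_ne hji]
    simp
  obtain ⟨ε, hε, hball⟩ := Metric.eventually_nhds_iff.1 hmem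
  refine ⟨⟨x + (-(ε / 2)) • v, hball ?_, ?_⟩, ⟨x + (ε / 2) • v, hball ?_, ?_⟩⟩
  · rw [Real.dist_eq, sub_zero, abs_neg, abs_of_pos (by linarith)]; linarith
  · rw [defect_add_smul, hxi, hvi]; linarith
  · rw [Real.dist_eq, sub_zero, abs_of_pos (by linarith)]; linarith
  · rw [defect_add_smul, hxi, hvi]; linarith

lemma mem_signCell_insert {x : Fin d → ℝ} : x ∈ signCell d n b r G (insert i I) P ↔
    x ∈ signCell d n b r G I P ∧
      (i ∈ P → 0 < defect d n b r i x) ∧ (i ∉ P → defect d n b r i x < 0) := by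
  simp only [signCell, Set.mem_sep_iff, Finset.forall_mem_insert]
  tauto

lemma mem_signCell_insert_flat {x : Fin d → ℝ} : x ∈ signCell d n b r (insert i G) I P ↔
    x ∈ signCell d n b r G I P ∧ defect d n b r i x = 0 := by
  simp only [signCell, Set.mem_ofPred_eq, mem_flat_iff, Finset.forall_mem_insert]
  tauto

lemma signCell_congr {Q : Finset (Fin n)} (h : ∀ j ∈ I, j ∈ P ↔ j ∈ Q) :
    signCell d n b r G I P = signCell d n b r G I Q := by
  ext x
  refine and_congr_right fun _ => forall₂_congr fun j hj => ?_
  rw [h j hj]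

lemma exists_defect_eq_zero {y z : Fin d → ℝ} (hy : y ∈ signCell d n b r G I P)
    (hz : z ∈ signCell d n b r G I P) (hyi : defect d n b r i y < 0)
    (hzi : 0 < defect d n b r i z) :
    ∃ x ∈ signCell d n b r G I P, defect d n b r i x = 0 :=
  convex_signCell.isPreconnected.intermediate_value hy hz continuous_defect.continuousOn
    ⟨hyi.le, hzi.le⟩

lemma card_patterns_insert (hr : Simple d n b r) (hiG : i ∉ G) (hiI : i ∉ I) :
    (patterns d n b r G (insert i I)).card =
      (patterns d n b r G I).card + (patterns d n b r (insert i G) I).card := by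
  set N := I.powerset.filter fun P => ∃ x ∈ signCell d n b r G I P, defect d n b r i x < 0
    with hN
  set Q := I.powerset.filter fun P => ∃ x ∈ signCell d n b r G I P, 0 < defect d n b r i x
    with hQ
  have hunion : N ∪ Q = patterns d n b r G I := by
    rw [hN, hQ, ← Finset.filter_or, patterns]
    refine Finset.filter_congr fun P _ => ⟨?_, ?_⟩
    · rintro (⟨x, hx, -⟩ | ⟨x, hx, -⟩) <;> exact ⟨x, hx⟩
    · rintro ⟨x, hx⟩
      rcases lt_trichotomy (defect d n b r i x) 0 with h | h | h
      · exact Or.inl ⟨x, hx, h⟩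
      · exact Or.inl (exists_signCell_both_sides hr hiG hx h).1
      · exact Or.inr ⟨x, hx, h⟩
  have hinter : N ∩ Q = patterns d n b r (insert i G) I := by
    rw [hN, hQ, ← Finset.filter_and, patterns]
    refine Finset.filter_congr fun P _ => ⟨?_, ?_⟩
    · rintro ⟨⟨y, hy, hyi⟩, ⟨z, hz, hzi⟩⟩
      obtain ⟨x, hx, hxi⟩ := exists_defect_eq_zero hy hz hyi hzi
      exact ⟨x, mem_signCell_insert_flat.2 ⟨hx, hxi⟩⟩
    · rintro ⟨x, hx⟩
      obtain ⟨hx, hxi⟩ := mem_signCell_insert_flat.1 hx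
      exact exists_signCell_both_sides hr hiG hx hxi
  have hinsert (P : Finset (Fin n)) :
      signCell d n b r G I (insert i P) = signCell d n b r G I P :=
    signCell_congr fun j hj =>
      Finset.mem_insert.trans (or_iff_right fun h => hiI (h ▸ hj))
  have hnotMem {P : Finset (Fin n)} (hP : P ∈ I.powerset) : i ∉ P :=
    fun h => hiI (Finset.mem_powerset.1 hP h)
  have hsplit : patterns d n b r G (insert i I) = N ∪ Q.image (insert i) := by
    rw [patterns, Finset.powerset_insert, Finset.filter_union, Finset.filter_image]
    congr 1
    · refine Finset.filter_congr fun P hP => exists_congr fun x => ?_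
      rw [mem_signCell_insert]
      simp [hnotMem hP]
    · congr 1
      refine Finset.filter_congr fun P hP => exists_congr fun x => ?_
      rw [mem_signCell_insert, hinsert]
      simp
  have hdisj : Disjoint N (Q.image (insert i)) := by
    rw [Finset.disjoint_left]
    intro P hP hP'
    obtain ⟨P', -, rfl⟩ := Finset.mem_image.1 hP'
    exact hnotMem (Finset.mem_filter.1 hP).1 (Finset.mem_insert_self i P')
  have hinj : Set.InjOn (insert i) (Q : Set (Finset (Fin n))) := fun P hP P' hP' h => by
    rw [← Finset.erase_insert (hnotMem (Finset.mem_filter.1 hP).1), h,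
      Finset.erase_insert (hnotMem (Finset.mem_filter.1 hP').1)]
  rw [hsplit, Finset.card_union_of_disjoint hdisj, Finset.card_image_of_injOn hinj, ← hunion,
    ← hinter, Finset.card_union_add_card_inter]

lemma card_indepBetween_insert (hiG : i ∉ G) (hiI : i ∉ I) :
    (indepBetween d n b G (insert i I)).card =
      (indepBetween d n b G I).card + (indepBetween d n b (insert i G) I).card := by
  rw [← Finset.card_filter_add_card_filter_not (s := indepBetween d n b G (insert i I))
    (fun G' => i ∉ G')]
  congr 2
  · ext G'
    simp only [indepBetween, Finset.mem_filter, Finset.mem_univ, true_and, Finset.subset_iff,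
      Finset.mem_union, Finset.mem_insert]
    grind
  · ext G'
    simp only [indepBetween, Finset.mem_filter, Finset.mem_univ, true_and, Finset.subset_iff,
      Finset.mem_union, Finset.mem_insert]
    grind

lemma card_patterns (hr : Simple d n b r) (hdisj : Disjoint G I) :
    (patterns d n b r G I).card = (indepBetween d n b G I).card := by
  induction I using Finset.induction_on generalizing G with
  | empty =>
    have hcell : (signCell d n b r G ∅ ∅).Nonempty ↔ memMatroid d n b G :=
      ⟨fun ⟨_, hx⟩ => hr.memMatroid_of_mem_flat_s14 hx.1,
        fun h => h.flat_nonempty.imp fun _ hx => ⟨hx, by simp⟩⟩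
    have hbetween : indepBetween d n b G ∅ = ({G} : Finset _).filter (memMatroid d n b) := by
      ext G'
      simp only [indepBetween, Finset.mem_filter, Finset.mem_univ, true_and, Finset.union_empty,
        Finset.mem_singleton, and_comm, ← Finset.Subset.antisymm_iff, eq_comm]
    rw [hbetween, patterns, Finset.powerset_empty, Finset.filter_singleton,
      Finset.filter_singleton]
    simp only [hcell]
    split_ifs <;> rfl
  | insert i I hiI ih =>
    rw [Finset.disjoint_insert_right] at hdisj
    rw [card_patterns_insert hr hdisj.1 hiI, card_indepBetween_insert hdisj.1 hiI, ih hdisj.2,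
      ih (Finset.disjoint_insert_left.2 ⟨hiI, hdisj.2⟩)]

lemma mem_flat_diff_iff {x : Fin d → ℝ} :
    x ∈ flat d n b r G \ ⋃ i ∈ I, hyperplane d n b r i ↔
      x ∈ flat d n b r G ∧ ∀ i ∈ I, defect d n b r i x ≠ 0 := by
  simp only [Set.mem_sdiff, Set.mem_iUnion, not_exists, mem_hyperplane_iff, ne_eq]

lemma signCell_subset : signCell d n b r G I P ⊆
    flat d n b r G \ ⋃ i ∈ I, hyperplane d n b r i := fun x hx => by
  refine mem_flat_diff_iff.2 ⟨hx.1, fun j hj => ?_⟩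
  by_cases hP : j ∈ P
  · exact ((hx.2 j hj).1 hP).ne'
  · exact ((hx.2 j hj).2 hP).ne

lemma connectedComponentIn_eq_signCell {x : Fin d → ℝ} (hx : x ∈ signCell d n b r G I P) :
    connectedComponentIn (flat d n b r G \ ⋃ i ∈ I, hyperplane d n b r i) x =
      signCell d n b r G I P := by
  refine subset_antisymm (fun y hy => ?_)
    (convex_signCell.isPreconnected.subset_connectedComponentIn hx signCell_subset)
  have hxU := signCell_subset hx
  have hsub := connectedComponentIn_subset (flat d n b r G \ ⋃ i ∈ I, hyperplane d n b r i) x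
  have hpre : IsPreconnected
      (connectedComponentIn (flat d n b r G \ ⋃ i ∈ I, hyperplane d n b r i) x) :=
    isPreconnected_connectedComponentIn
  have hxC := mem_connectedComponentIn hxU
  refine ⟨(hsub hy).1, fun j hj => ⟨fun hP => ?_, fun hP => ?_⟩⟩
  · by_contra! h
    obtain ⟨z, hz, hz0⟩ := hpre.intermediate_value hy hxC
      (continuous_defect (b := b) (r := r) (i := j)).continuousOn ⟨h, ((hx.2 j hj).1 hP).le⟩
    exact (mem_flat_diff_iff.1 (hsub hz)).2 j hj hz0
  · by_contra! h
    obtain ⟨z, hz, hz0⟩ := hpre.intermediate_value hxC hy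
      (continuous_defect (b := b) (r := r) (i := j)).continuousOn ⟨((hx.2 j hj).2 hP).le, h⟩
    exact (mem_flat_diff_iff.1 (hsub hz)).2 j hj hz0

lemma setOf_regions_eq_image :
    {R : Set (Fin d → ℝ) | ∃ x ∈ flat d n b r G \ ⋃ i ∈ I, hyperplane d n b r i,
      R = connectedComponentIn (flat d n b r G \ ⋃ i ∈ I, hyperplane d n b r i) x} =
      signCell d n b r G I '' patterns d n b r G I := by
  ext R
  simp only [Set.mem_ofPred_eq, Set.mem_image, patterns, Finset.coe_filter, Finset.mem_powerset]
  constructor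
  · rintro ⟨x, hx, rfl⟩
    obtain ⟨hxG, hxI⟩ := mem_flat_diff_iff.1 hx
    have hcell : x ∈ signCell d n b r G I (I.filter fun j => 0 < defect d n b r j x) :=
      ⟨hxG, fun j hj => ⟨fun h => (Finset.mem_filter.1 h).2, fun h =>
        lt_of_le_of_ne (not_lt.1 fun h' => h (Finset.mem_filter.2 ⟨hj, h'⟩)) (hxI j hj)⟩⟩
    exact ⟨_, ⟨Finset.filter_subset _ _, x, hcell⟩, (connectedComponentIn_eq_signCell hcell).symm⟩
  · rintro ⟨P, ⟨-, x, hx⟩, rfl⟩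
    exact ⟨x, signCell_subset hx, (connectedComponentIn_eq_signCell hx).symm⟩

lemma injOn_signCell : Set.InjOn (signCell d n b r G I) (patterns d n b r G I) := by
  intro P hP Q hQ h
  obtain ⟨hPI, x, hxP⟩ := Finset.mem_filter.1 hP
  obtain ⟨hQI, -⟩ := Finset.mem_filter.1 hQ
  have hxQ : x ∈ signCell d n b r G I Q := h ▸ hxP
  rw [Finset.mem_powerset] at hPI hQI
  ext j
  constructor
  · intro hj
    by_contra hj'
    exact lt_asymm ((hxP.2 j (hPI hj)).1 hj) ((hxQ.2 j (hPI hj)).2 hj')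
  · intro hj
    by_contra hj'
    exact lt_asymm ((hxQ.2 j (hQI hj)).1 hj) ((hxP.2 j (hQI hj)).2 hj')

end

/-- the number of regions of the arrangement `{H_i ∩ A_G : i ∈ I}` in `A_G`
equals the number of `G' ∈ M_B` with `G ⊆ G' ⊆ G ∪ I`. -/
theorem statement14 (d n : ℕ) (hd : 0 < d) (hn : 0 < n)
    (b : Fin n → Fin d → ℤ) (hb : ∀ i, b i ≠ 0)
    (hgen : Submodule.span ℤ (Set.range b) = ⊤)
    (r : Fin n → ℝ) (hr : Simple d n b r)
    (G : Finset (Fin n)) (hG : memMatroid d n b G)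
    (I : Finset (Fin n)) (hI : ∀ i ∈ I, toR d (b i) ∉ spanF d n b G) :
    Nat.card {R : Set (Fin d → ℝ) |
        ∃ x ∈ flat d n b r G \ ⋃ i ∈ I, hyperplane d n b r i,
          R = connectedComponentIn (flat d n b r G \ ⋃ i ∈ I, hyperplane d n b r i) x}
      = Nat.card {G' : Finset (Fin n) |
          memMatroid d n b G' ∧ G ⊆ G' ∧ G' ⊆ G ∪ I} := by
  have hdisj : Disjoint G I := Finset.disjoint_left.2 fun i hiG hiI =>
    hI i hiI (Submodule.subset_span ⟨i, hiG, rfl⟩)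
  rw [setOf_regions_eq_image, Nat.card_image_of_injOn injOn_signCell, Nat.card_coe_set_eq,
    Set.ncard_coe_finset, card_patterns hr hdisj, indepBetween, ← Set.ncard_coe_finset,
    ← Nat.card_coe_set_eq, Finset.coe_filter]
  simp

end LawrencePaper
end
end

section
/- Let F = {b_{k_1}, …, b_{k_d}} be an element of M_B of dimension d (a linearly independent subset of the configuration spanning ℝ^d), and let N_F ⊆ ℤ^d be the sublattice generated by the elements of F. Then the index [ℤ^d : N_F] equals Σ_{G ⊆ F} #(BOX(G) ∩ ℤ^d), the sum being over all subsets G of F. -/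
open scoped BigOperators Pointwise
open Polynomial

noncomputable section

namespace LawrencePaper

attribute [local instance] Classical.propDecidable

/-- The map `toR` as a `ℤ`-linear map. -/
def toRLinear (d : ℕ) : (Fin d → ℤ) →ₗ[ℤ] (Fin d → ℝ) :=
  ((Int.castAddHom ℝ).compLeft (Fin d)).toIntLinearMap

lemma toRLinear_apply (d : ℕ) (z : Fin d → ℤ) : toRLinear d z = toR d z := rfl

lemma toRLinear_injective (d : ℕ) : Function.Injective (toRLinear d) := fun x y h => by
  ext j
  have := congrFun h j
  simpa [toRLinear] using this

lemma exists_basis_toR (d n : ℕ) (b : Fin n → Fin d → ℤ) (F : Finset (Fin n))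
    (hF : memMatroid d n b F) (hdim : dimF d n b F = d) :
    ∃ β : Module.Basis F ℝ (Fin d → ℝ), ∀ i, β i = toR d (b i) := by
  have hspan : spanF d n b F = ⊤ := Submodule.eq_top_of_finrank_eq (by
    rw [Module.finrank_fin_fun]; exact hdim)
  have hrange : Set.range (fun i : F => toR d (b i.1)) = (fun i => toR d (b i)) '' F := by
    ext x; simp
  have hli : LinearIndependent ℝ (fun i : F => toR d (b i.1)) := hF
  have hle : ⊤ ≤ Submodule.span ℝ (Set.range fun i : F => toR d (b i.1)) := by
    rw [hrange]
    exact hspan.ge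
  exact ⟨Module.Basis.mk hli hle, fun i => Module.Basis.mk_apply hli hle i⟩

lemma span_range_eq_map_toRLinear (d n : ℕ) (b : Fin n → Fin d → ℤ) (F : Finset (Fin n))
    (β : Module.Basis F ℝ (Fin d → ℝ)) (hβ : ∀ i, β i = toR d (b i)) :
    Submodule.span ℤ (Set.range β) =
      (Submodule.span ℤ ((fun i => b i) '' (F : Set (Fin n)))).map (toRLinear d) := by
  rw [Submodule.map_span]
  congr 1
  ext x
  simp [hβ, toRLinear_apply]

lemma finite_toR_mem (d : ℕ) {s : Set (Fin d → ℝ)} (hs : Bornology.IsBounded s) :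
    {z : Fin d → ℤ | toR d z ∈ s}.Finite := by
  have h := ZSpan.setFinite_inter (Pi.basisFun ℝ (Fin d)) hs
  refine (h.preimage (toRLinear_injective d).injOn).subset fun z hz => ⟨hz, ?_⟩
  rw [SetLike.mem_coe, Module.Basis.mem_span_iff_repr_mem]
  intro j
  exact ⟨z j, by simp [toRLinear_apply, toR]⟩

/-- The integer points of the fundamental domain represent each coset exactly once. -/
lemma index_eq_card_fundamentalDomain (d n : ℕ) (b : Fin n → Fin d → ℤ) (F : Finset (Fin n))
    (β : Module.Basis F ℝ (Fin d → ℝ)) (hβ : ∀ i, β i = toR d (b i)) :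
    (Submodule.span ℤ ((fun i => b i) '' (F : Set (Fin n)))).toAddSubgroup.index =
      Nat.card {z : Fin d → ℤ | toR d z ∈ ZSpan.fundamentalDomain β} := by
  set N := (Submodule.span ℤ ((fun i => b i) '' (F : Set (Fin n)))).toAddSubgroup with hN
  have hmem : ∀ z, z ∈ N ↔ toR d z ∈ Submodule.span ℤ (Set.range β) := fun z => by
    rw [span_range_eq_map_toRLinear d n b F β hβ]
    exact ((toRLinear_injective d).mem_set_image).symm
  refine (Nat.card_congr (Equiv.ofBijective
    (fun z : {z : Fin d → ℤ | toR d z ∈ ZSpan.fundamentalDomain β} =>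
      (QuotientAddGroup.mk z.1 : (Fin d → ℤ) ⧸ N)) ⟨?_, ?_⟩)).symm
  · rintro ⟨x, hx⟩ ⟨y, hy⟩ hxy
    have h := (hmem _).1 (QuotientAddGroup.eq.1 hxy)
    have h' : -toR d x + toR d y ∈ Submodule.span ℤ (Set.range β) := by
      simpa only [← toRLinear_apply, map_add, map_neg] using h
    rw [← ZSpan.fract_eq_fract, ZSpan.fract_eq_self.2 hx, ZSpan.fract_eq_self.2 hy] at h'
    exact Subtype.ext (toRLinear_injective d h')
  · intro q
    obtain ⟨z, rfl⟩ := QuotientAddGroup.mk_surjective q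
    obtain ⟨w, hw, hwz⟩ := (span_range_eq_map_toRLinear d n b F β hβ).le
      (ZSpan.floor β (toR d z)).2
    refine ⟨⟨z - w, ?_⟩, ?_⟩
    · have : toR d (z - w) = ZSpan.fract β (toR d z) := by
        rw [ZSpan.fract_apply, ← hwz, ← toRLinear_apply, ← toRLinear_apply, map_sub]
      rw [Set.mem_ofPred_eq, this]
      exact ZSpan.fract_mem_fundamentalDomain β _
    · refine QuotientAddGroup.eq.2 ?_
      have : -(z - w) + z = w := by abel
      rw [this]
      exact hw

lemma mem_box_iff_repr (d n : ℕ) (b : Fin n → Fin d → ℤ) (F : Finset (Fin n))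
    (β : Module.Basis F ℝ (Fin d → ℝ)) (hβ : ∀ i, β i = toR d (b i))
    {G : Finset (Fin n)} (hG : G ⊆ F) (x : Fin d → ℝ) :
    x ∈ box d n b G ↔ ∀ i : F, (i.1 ∈ G → 0 < β.repr x i ∧ β.repr x i < 1) ∧
      (i.1 ∉ G → β.repr x i = 0) := by
  have key : ∀ α : Fin n → ℝ, ∑ i ∈ G, α i • toR d (b i) =
      ∑ i : F, (if i.1 ∈ G then α i else 0) • β i := by
    intro α
    simp only [hβ]
    rw [Finset.sum_coe_sort F (fun i => (if i ∈ G then α i else 0) • toR d (b i))]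
    simp only [ite_smul, zero_smul]
    rw [← Finset.sum_filter, Finset.filter_mem_eq_inter, Finset.inter_eq_right.2 hG]
  constructor
  · rintro ⟨α, hα, rfl⟩ i
    rw [key, Module.Basis.repr_sum_self]
    constructor <;> intro hi
    · simpa [hi] using hα i hi
    · simp [hi]
  · intro h
    refine ⟨fun i => if hi : i ∈ F then β.repr x ⟨i, hi⟩ else 0, fun i hi => ?_, ?_⟩
    · simpa [hG hi] using (h ⟨i, hG hi⟩).1 hi
    · rw [key]
      conv_lhs => rw [← β.sum_repr x]
      refine Finset.sum_congr rfl fun i _ => ?_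
      by_cases hi : i.1 ∈ G
      · simp [hi]
      · simp [hi, (h i).2 hi]

/-- The half-open fundamental domain is the disjoint union of the boxes of the subsets of `F`. -/
lemma card_fundamentalDomain_eq_sum (d n : ℕ) (b : Fin n → Fin d → ℤ) (F : Finset (Fin n))
    (β : Module.Basis F ℝ (Fin d → ℝ)) (hβ : ∀ i, β i = toR d (b i)) :
    Nat.card {z : Fin d → ℤ | toR d z ∈ ZSpan.fundamentalDomain β} =
      ∑ G ∈ F.powerset, boxCount d n b G := by
  have hfin := finite_toR_mem d (ZSpan.fundamentalDomain_isBounded β)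
  have hunion : {z : Fin d → ℤ | toR d z ∈ ZSpan.fundamentalDomain β} =
      ⋃ G ∈ (F.powerset : Set (Finset (Fin n))), {z : Fin d → ℤ | toR d z ∈ box d n b G} := by
    ext z
    simp only [Set.mem_ofPred_eq, Set.mem_iUnion, ZSpan.mem_fundamentalDomain, Finset.mem_coe,
      Finset.mem_powerset, exists_prop]
    constructor
    · intro h
      have hsub : {i ∈ F | ∃ hi : i ∈ F, β.repr (toR d z) ⟨i, hi⟩ ≠ 0} ⊆ F :=
        Finset.filter_subset _ _
      refine ⟨_, hsub, (mem_box_iff_repr d n b F β hβ hsub _).2 fun i => ⟨fun hi => ?_, ?_⟩⟩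
      · obtain ⟨_, hne⟩ := (Finset.mem_filter.1 hi).2
        exact ⟨lt_of_le_of_ne (h i).1 hne.symm, (h i).2⟩
      · intro hi
        by_contra hne
        exact hi (Finset.mem_filter.2 ⟨i.2, i.2, hne⟩)
    · rintro ⟨G, hG, hz⟩ i
      have h := (mem_box_iff_repr d n b F β hβ hG _).1 hz i
      by_cases hi : i.1 ∈ G
      · exact ⟨(h.1 hi).1.le, (h.1 hi).2⟩
      · simp [h.2 hi]
  have hdisj : (F.powerset : Set (Finset (Fin n))).PairwiseDisjoint
      (fun G => {z : Fin d → ℤ | toR d z ∈ box d n b G}) := by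
    intro G hG H hH hne
    refine Set.disjoint_left.2 fun z hzG hzH => hne ?_
    have hG' := Finset.mem_powerset.1 hG
    have hH' := Finset.mem_powerset.1 hH
    have h₁ := (mem_box_iff_repr d n b F β hβ hG' _).1 hzG
    have h₂ := (mem_box_iff_repr d n b F β hβ hH' _).1 hzH
    ext i
    constructor <;> intro hi <;> by_contra hni
    · exact ((h₁ ⟨i, hG' hi⟩).1 hi).1.ne' ((h₂ ⟨i, hG' hi⟩).2 hni)
    · exact ((h₂ ⟨i, hH' hi⟩).1 hi).1.ne' ((h₁ ⟨i, hH' hi⟩).2 hni)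
  have hfinG : ∀ G ∈ F.powerset, {z : Fin d → ℤ | toR d z ∈ box d n b G}.Finite := by
    intro G hG
    refine hfin.subset ?_
    rw [hunion]
    exact Set.subset_biUnion_of_mem (u := fun G => {z : Fin d → ℤ | toR d z ∈ box d n b G}) hG
  rw [Nat.card_coe_set_eq, hunion,
    Set.Finite.ncard_biUnion F.powerset.finite_toSet hfinG hdisj, finsum_mem_coe_finset]
  rfl

/-- for a maximal-dimensional `F ∈ M_B`, the index of the sublattice `N_F`
generated by `F` equals `Σ_{G ⊆ F} #(BOX(G) ∩ ℤ^d)`. -/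
theorem statement15 (d n : ℕ) (hd : 0 < d) (hn : 0 < n)
    (b : Fin n → Fin d → ℤ) (hb : ∀ i, b i ≠ 0)
    (hgen : Submodule.span ℤ (Set.range b) = ⊤)
    (F : Finset (Fin n)) (hF : memMatroid d n b F) (hdim : dimF d n b F = d) :
    (Submodule.span ℤ ((fun i => b i) '' (F : Set (Fin n)))).toAddSubgroup.index
      = ∑ G ∈ F.powerset, boxCount d n b G := by
  obtain ⟨β, hβ⟩ := exists_basis_toR d n b F hF hdim
  rw [index_eq_card_fundamentalDomain d n b F β hβ, card_fundamentalDomain_eq_sum d n b F β hβ]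

end LawrencePaper
end
end
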